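/- arXiv:2012.09621 — 3 statements merged into one kernel-verified Lean document; each statement's English description precedes it below -/
import Mathlib

section
/- For every M > 1 there exist constants c₀, C > 0 such that for all L > 0, μ > 0 and E_B < 0 with L²|E_B| ≥ 1 and μ/|E_B| ≥ c₀, every e_P < 0 solving the polaron equation satisfies | e_P + (1 + 1/M)·μ/log(μ/|E_B|) | ≤ C μ/(log(μ/|E_B|))². -/
open Real MeasureTheory Set

/-- The momentum lattice point `(2π/L)·z` for `z ∈ ℤ²`. -/
noncomputable def kvec (L : ℝ) (z : ℤ × ℤ) : ℝ × ℝ :=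
  ((2 * Real.pi / L) * z.1, (2 * Real.pi / L) * z.2)

/-- Euclidean norm squared on `ℝ²`. -/
noncomputable def nsq (v : ℝ × ℝ) : ℝ := v.1 ^ 2 + v.2 ^ 2

/-- `χ_{(μ,∞)}(s)`. -/
noncomputable def chi (μ s : ℝ) : ℝ := if μ < s then 1 else 0

/-- The function `G(q,τ)` (with `m = 1 + 1/M`). -/
noncomputable def Gfun (M L E_B μ : ℝ) (q : ℝ × ℝ) (τ : ℝ) : ℝ :=
  (1 / L ^ 2) * ∑' z : ℤ × ℤ,
    (1 / ((1 + 1 / M) * nsq (kvec L z) + |E_B|)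
      - chi μ (nsq (kvec L z)) / ((1 / M) * nsq (q - kvec L z) + nsq (kvec L z) + τ))

/-- The free Fermi energy `E₀(μ) = Σ_{|k|² ≤ μ} |k|²`. -/
noncomputable def E0 (L μ : ℝ) : ℝ :=
  ∑' z : ℤ × ℤ, if nsq (kvec L z) ≤ μ then nsq (kvec L z) else 0

/-- The particle number `N(μ) = card{k ∈ Λ_L : |k|² ≤ μ}`. -/
noncomputable def Nmu (L μ : ℝ) : ℕ := Nat.card {z : ℤ × ℤ // nsq (kvec L z) ≤ μ}

/-- `e` solves the polaron equation. -/
def PolaronEq (M L E_B μ e : ℝ) : Prop :=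
  e = -((1 / L ^ 2) * ∑' z : ℤ × ℤ,
    if nsq (kvec L z) ≤ μ then
      1 / Gfun M L E_B μ (kvec L z) (-(nsq (kvec L z)) - e) else 0)

/-- The Euclidean norm squared of an integer point. -/
noncomputable def latSq (z : ℤ × ℤ) : ℝ := (z.1 : ℝ) ^ 2 + (z.2 : ℝ) ^ 2

/-- The sup norm of an integer point. -/
def latSup (z : ℤ × ℤ) : ℕ := max z.1.natAbs z.2.natAbs

lemma latSq_nonneg (z : ℤ × ℤ) : 0 ≤ latSq z := by unfold latSq; positivity

lemma abs_fst_le_latSup (z : ℤ × ℤ) : |(z.1 : ℝ)| ≤ latSup z := by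
  have h : z.1.natAbs ≤ latSup z := le_max_left _ _
  have h' : ((z.1.natAbs : ℕ) : ℝ) ≤ latSup z := by exact_mod_cast h
  simpa [Nat.cast_natAbs] using h'

lemma abs_snd_le_latSup (z : ℤ × ℤ) : |(z.2 : ℝ)| ≤ latSup z := by
  have h : z.2.natAbs ≤ latSup z := le_max_right _ _
  have h' : ((z.2.natAbs : ℕ) : ℝ) ≤ latSup z := by exact_mod_cast h
  simpa [Nat.cast_natAbs] using h'

lemma latSup_sq_le (z : ℤ × ℤ) : (latSup z : ℝ) ^ 2 ≤ latSq z := by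
  unfold latSup latSq
  rcases max_choice z.1.natAbs z.2.natAbs with h | h <;> rw [h] <;>
    simp only [Nat.cast_natAbs, Int.cast_abs, sq_abs] <;> nlinarith [sq_nonneg (z.1 : ℝ), sq_nonneg (z.2 : ℝ)]

lemma latSq_le (z : ℤ × ℤ) : latSq z ≤ 2 * (latSup z : ℝ) ^ 2 := by
  have h1 := sq_le_sq' (by linarith [neg_abs_le (z.1 : ℝ), abs_fst_le_latSup z])
    ((le_abs_self _).trans (abs_fst_le_latSup z))
  have h2 := sq_le_sq' (by linarith [neg_abs_le (z.2 : ℝ), abs_snd_le_latSup z])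
    ((le_abs_self _).trans (abs_snd_le_latSup z))
  unfold latSq; linarith

/-- A radial weight whose lattice sum is bounded uniformly in `ρ`. -/
noncomputable def radialWeight (ρ : ℝ) (z : ℤ × ℤ) : ℝ :=
  ρ / (latSup z * (latSup z + ρ) ^ 2)

lemma radialWeight_nonneg {ρ : ℝ} (hρ : 0 < ρ) (z : ℤ × ℤ) : 0 ≤ radialWeight ρ z := by
  unfold radialWeight; positivity

lemma sum_radialWeight_le {ρ : ℝ} (hρ : 0 < ρ) (s : Finset (ℤ × ℤ)) :
    ∑ z ∈ s, radialWeight ρ z ≤ 8 := by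
  classical
  obtain ⟨N, hN⟩ : ∃ N : ℕ, ∀ z ∈ s, latSup z < N + 1 := by
    refine ⟨s.sup latSup, fun z hz => Nat.lt_succ_of_le (Finset.le_sup hz)⟩
  rw [← Finset.sum_fiberwise_of_maps_to (t := Finset.range (N + 1)) (g := latSup)
    (fun z hz => Finset.mem_range.2 (hN z hz))]
  have key : ∀ k : ℕ, ∑ z ∈ s with latSup z = k, radialWeight ρ z
      ≤ 8 * k * (ρ / (k * (k + ρ) ^ 2)) := by
    intro k
    rcases Nat.eq_zero_or_pos k with rfl | hk
    · refine le_of_eq ?_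
      rw [Finset.sum_eq_zero]
      · simp
      · intro z hz
        simp [radialWeight, (Finset.mem_filter.1 hz).2]
    · have hc : (Finset.filter (fun z => latSup z = k) s).card ≤ 8 * k := by
        rw [← Int.card_box hk.ne']
        refine Finset.card_le_card fun z hz => ?_
        rw [Int.mem_box]
        exact (Finset.mem_filter.1 hz).2
      have : ∑ z ∈ s with latSup z = k, radialWeight ρ z
          = ((Finset.filter (fun z => latSup z = k) s).card : ℝ) * (ρ / (k * (k + ρ) ^ 2)) := by
        rw [← nsmul_eq_mul]
        refine Finset.sum_eq_card_nsmul fun z hz => ?_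
        simp [radialWeight, (Finset.mem_filter.1 hz).2]
      rw [this]
      have hc' : ((Finset.filter (fun z => latSup z = k) s).card : ℝ) ≤ 8 * k := by
        exact_mod_cast hc
      gcongr
  refine (Finset.sum_le_sum fun k _ => key k).trans ?_
  have tel : ∀ n : ℕ, ∑ k ∈ Finset.range (n + 1), 8 * (k : ℝ) * (ρ / (k * (k + ρ) ^ 2))
      ≤ 8 * (1 - ρ / (n + ρ)) := by
    intro n
    induction n with
    | zero => simp [hρ.ne']
    | succ n ih =>
      rw [Finset.sum_range_succ]
      have hn : (0 : ℝ) ≤ n := Nat.cast_nonneg n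
      have : 8 * ((n + 1 : ℕ) : ℝ) * (ρ / ((n + 1 : ℕ) * ((n + 1 : ℕ) + ρ) ^ 2))
          ≤ 8 * (ρ / (n + ρ) - ρ / ((n + 1 : ℕ) + ρ)) := by
        push_cast
        have e1 : 8 * ((n : ℝ) + 1) * (ρ / ((n + 1) * (n + 1 + ρ) ^ 2))
          = 8 * (ρ / (n + 1 + ρ) ^ 2) := by field_simp
        have e2 : ρ / (n + ρ) - ρ / ((n : ℝ) + 1 + ρ) = ρ / ((n + ρ) * (n + 1 + ρ)) := by
          field_simp; ring
        rw [e1, e2]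
        have : ((n : ℝ) + ρ) * (n + 1 + ρ) ≤ (n + 1 + ρ) ^ 2 := by nlinarith
        gcongr
      linarith
  refine (tel N).trans ?_
  have : 0 ≤ ρ / (N + ρ) := by positivity
  linarith

lemma latSup_pos_of_lt {ρ : ℝ} (hρ : 0 < ρ) {z : ℤ × ℤ} (hz : ρ ^ 2 < latSq z) :
    (1 : ℝ) ≤ latSup z ∧ ρ ≤ 2 * latSup z := by
  have h := latSq_le z
  have hk : (0 : ℝ) ≤ latSup z := Nat.cast_nonneg _
  have h1 : ρ ≤ 2 * latSup z := by
    by_contra hc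
    push Not at hc
    nlinarith
  refine ⟨?_, h1⟩
  have : 0 < latSup z := by
    have : (0 : ℝ) < latSup z := by linarith
    exact_mod_cast this
  exact_mod_cast this

lemma div_cube_le_radialWeight {ρ : ℝ} (hρ : 0 < ρ) {z : ℤ × ℤ} (hz : ρ ^ 2 < latSq z) :
    ρ / (latSup z : ℝ) ^ 3 ≤ 9 * radialWeight ρ z := by
  obtain ⟨h1, h2⟩ := latSup_pos_of_lt hρ hz
  unfold radialWeight
  set k : ℝ := ((latSup z : ℕ) : ℝ)
  rw [mul_div_assoc', div_le_div_iff₀ (by positivity) (by positivity)]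
  have : (k + ρ) ^ 2 ≤ 9 * k ^ 2 := by nlinarith
  calc ρ * (k * (k + ρ) ^ 2) ≤ ρ * (k * (9 * k ^ 2)) := by gcongr
    _ = 9 * ρ * k ^ 3 := by ring

/-- On the shell `ρ² < |z|² ≤ 4ρ²` the inverse square of `ρ` is dominated by the weight. -/
lemma one_div_sq_le_radialWeight {ρ : ℝ} (hρ : 0 < ρ) {z : ℤ × ℤ} (hz : ρ ^ 2 < latSq z)
    (hz' : latSq z ≤ 4 * ρ ^ 2) :
    1 / (latSup z : ℝ) ^ 2 ≤ 18 * radialWeight ρ z ∧ 1 / ρ ^ 2 ≤ 72 * radialWeight ρ z := by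
  obtain ⟨h1, h2⟩ := latSup_pos_of_lt hρ hz
  have h3 := div_cube_le_radialWeight hρ hz
  have h4 := latSup_sq_le z
  set k : ℝ := ((latSup z : ℕ) : ℝ)
  have hk : k ≤ 2 * ρ := by nlinarith
  have e : 1 / k ^ 2 ≤ 2 * (ρ / k ^ 3) := by
    rw [mul_div_assoc', div_le_div_iff₀ (by positivity) (by positivity)]
    calc 1 * k ^ 3 = k * k ^ 2 := by ring
      _ ≤ 2 * ρ * k ^ 2 := by gcongr
  have e' : 1 / ρ ^ 2 ≤ 4 * (1 / k ^ 2) := by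
    rw [mul_div_assoc', div_le_div_iff₀ (by positivity) (by positivity)]
    nlinarith
  constructor <;> linarith

lemma sum_Icc_one_div_sq_add_le {A : ℝ} (hA : 1 ≤ A) (B : ℕ) :
    ∑ n ∈ Finset.Icc (-(B : ℤ)) B, 1 / ((n : ℝ) ^ 2 + A ^ 2) ≤ 5 / A := by
  have hA0 : 0 < A := by linarith
  suffices h : ∑ n ∈ Finset.Icc (-(B : ℤ)) B, 1 / ((n : ℝ) ^ 2 + A ^ 2) ≤ 5 / A - 4 / (B + A) by
    have : 0 ≤ 4 / (B + A) := by positivity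
    linarith
  induction B with
  | zero =>
    simp only [Nat.cast_zero, neg_zero, Finset.Icc_self, Finset.sum_singleton, Int.cast_zero]
    have : 1 / A ^ 2 ≤ 1 / A := one_div_le_one_div_of_le hA0 (by nlinarith)
    have e : 5 / A - 4 / (0 + A) = 1 / A := by rw [zero_add]; field_simp; norm_num
    rw [e]; simpa using this
  | succ B ih =>
    have hs : Finset.Icc (-((B + 1 : ℕ) : ℤ)) ((B + 1 : ℕ) : ℤ)
        = insert ((B : ℤ) + 1) (insert (-((B : ℤ) + 1)) (Finset.Icc (-(B : ℤ)) B)) := by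
      ext x; simp only [Finset.mem_Icc, Finset.mem_insert]; omega
    rw [hs, Finset.sum_insert (by simp; omega), Finset.sum_insert (by simp)]
    push_cast
    have hB : (0 : ℝ) ≤ B := Nat.cast_nonneg B
    have e2 : (-((B : ℝ) + 1)) ^ 2 = (B + 1) ^ 2 := by ring
    have e : 1 / (((B : ℝ) + 1) ^ 2 + A ^ 2) ≤ 2 * (1 / (B + A) - 1 / (B + 1 + A)) := by
      have : 1 / ((B : ℝ) + A) - 1 / (B + 1 + A) = 1 / ((B + A) * (B + 1 + A)) := by
        field_simp; ring
      rw [this, mul_div_assoc', div_le_div_iff₀ (by positivity) (by positivity)]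
      nlinarith [sq_nonneg ((B : ℝ) + 1 - A)]
    simp only [e2]
    have : 4 / ((B : ℝ) + A) - 4 / (B + 1 + A) = 4 * (1 / (B + A) - 1 / (B + 1 + A)) := by ring
    linarith

lemma sum_range_one_div_sqrt_le {ρ : ℝ} (hρ : 0 < ρ) (J : ℕ) :
    ∑ j ∈ Finset.range (J + 1), 1 / √(1 + j * ρ) ≤ 1 + 2 * √(J / ρ) := by
  induction J with
  | zero => simp
  | succ J ih =>
    rw [Finset.sum_range_succ]
    have hJ : (0 : ℝ) ≤ J := Nat.cast_nonneg J
    have h1 : 1 / √(1 + ((J + 1 : ℕ) : ℝ) * ρ) ≤ 1 / √((J + 1) * ρ) := by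
      push_cast
      refine one_div_le_one_div_of_le (by positivity) (Real.sqrt_le_sqrt (by linarith))
    have h2 : 1 / √(((J : ℝ) + 1) * ρ) ≤ 2 * √((J + 1 : ℕ) / ρ) - 2 * √(J / ρ) := by
      push_cast
      rw [Real.sqrt_mul (by positivity), Real.sqrt_div (by positivity), Real.sqrt_div hJ]
      have hr : 0 < √ρ := Real.sqrt_pos.2 hρ
      have hb : 0 < √((J : ℝ) + 1) := Real.sqrt_pos.2 (by positivity)
      have ha : 0 ≤ √(J : ℝ) := Real.sqrt_nonneg _
      have ea := Real.sq_sqrt hJ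
      have eb := Real.sq_sqrt (show (0 : ℝ) ≤ J + 1 by positivity)
      set r := √ρ
      set a := √(J : ℝ)
      set b := √((J : ℝ) + 1)
      have : 2 * (b / r) - 2 * (a / r) = 2 * (b - a) / r := by ring
      rw [this, div_le_div_iff₀ (by positivity) hr]
      have : 1 ≤ 2 * (b - a) * b := by nlinarith [sq_nonneg (b - a)]
      nlinarith
    linarith

/-- The integer points of norm squared at most `K`. -/
noncomputable def latDisc (K : ℕ) : Finset (ℤ × ℤ) :=
  (Finset.Icc (-(K : ℤ)) K ×ˢ Finset.Icc (-(K : ℤ)) K).filter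
    fun z => z.1 ^ 2 + z.2 ^ 2 ≤ (K : ℤ)

lemma mem_latDisc_iff {K : ℕ} {z : ℤ × ℤ} : z ∈ latDisc K ↔ z.1 ^ 2 + z.2 ^ 2 ≤ (K : ℤ) := by
  simp only [latDisc, Finset.mem_filter, Finset.mem_product, Finset.mem_Icc]
  refine ⟨fun h => h.2, fun h => ⟨⟨⟨?_, ?_⟩, ?_, ?_⟩, h⟩⟩ <;>
    nlinarith [sq_nonneg z.1, sq_nonneg z.2, Int.le_self_sq z.1, Int.le_self_sq z.2,
      Int.le_self_sq (-z.1), Int.le_self_sq (-z.2)]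

lemma mem_latDisc_floor {R : ℝ} (hR : 0 ≤ R) {z : ℤ × ℤ} :
    z ∈ latDisc ⌊R⌋₊ ↔ latSq z ≤ R := by
  obtain ⟨n, hn⟩ : ∃ n : ℕ, z.1 ^ 2 + z.2 ^ 2 = (n : ℤ) :=
    Int.eq_ofNat_of_zero_le (by positivity)
  have hn' : latSq z = n := by
    unfold latSq; exact_mod_cast hn
  rw [mem_latDisc_iff, hn, hn', ← Nat.le_floor_iff hR]
  exact_mod_cast Iff.rfl

lemma mem_latDisc {K : ℕ} {z : ℤ × ℤ} : z ∈ latDisc K ↔ latSq z ≤ K := by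
  have := mem_latDisc_floor (R := K) (Nat.cast_nonneg K) (z := z)
  rwa [Nat.floor_natCast] at this

/-- The unit cell of `ℂ` with lower left corner at `z`, shifted by one half. -/
def unitCell (z : ℤ × ℤ) : Set ℂ :=
  Complex.measurableEquivRealProd ⁻¹'
    (Set.Ico ((z.1 : ℝ) - 1 / 2) (z.1 + 1 / 2) ×ˢ Set.Ico ((z.2 : ℝ) - 1 / 2) (z.2 + 1 / 2))

lemma mem_unitCell {z : ℤ × ℤ} {p : ℂ} : p ∈ unitCell z ↔
    ((z.1 : ℝ) - 1 / 2 ≤ p.re ∧ p.re < z.1 + 1 / 2) ∧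
      ((z.2 : ℝ) - 1 / 2 ≤ p.im ∧ p.im < z.2 + 1 / 2) := by
  simp [unitCell, Complex.measurableEquivRealProd_apply]

lemma measurableSet_unitCell (z : ℤ × ℤ) : MeasurableSet (unitCell z) :=
  Complex.measurableEquivRealProd.measurable (measurableSet_Ico.prod measurableSet_Ico)

lemma volume_unitCell (z : ℤ × ℤ) : volume (unitCell z) = 1 := by
  unfold unitCell
  rw [Complex.volume_preserving_equiv_real_prod.measure_preimage
    (measurableSet_Ico.prod measurableSet_Ico).nullMeasurableSet, Measure.volume_eq_prod,
    Measure.prod_prod, Real.volume_Ico, Real.volume_Ico]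
  ring_nf
  simp

lemma disjoint_unitCell {z w : ℤ × ℤ} (h : z ≠ w) : Disjoint (unitCell z) (unitCell w) := by
  rw [Set.disjoint_left]
  intro p hz hw
  rw [mem_unitCell] at hz hw
  apply h
  have aux : ∀ a b : ℤ, ∀ x : ℝ, (a : ℝ) - 1 / 2 ≤ x → x < a + 1 / 2 → (b : ℝ) - 1 / 2 ≤ x →
      x < b + 1 / 2 → a = b := by
    intro a b x h1 h2 h3 h4
    have h5 : (a : ℝ) < b + 1 := by linarith
    have h6 : (b : ℝ) < a + 1 := by linarith
    have h7 : a < b + 1 := by exact_mod_cast h5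
    have h8 : b < a + 1 := by exact_mod_cast h6
    omega
  exact Prod.ext (aux _ _ _ hz.1.1 hz.1.2 hw.1.1 hw.1.2) (aux _ _ _ hz.2.1 hz.2.2 hw.2.1 hw.2.2)

lemma volume_iUnion_unitCell (s : Finset (ℤ × ℤ)) :
    volume (⋃ z ∈ s, unitCell z) = s.card := by
  rw [measure_biUnion_finset (fun z _ w _ h => disjoint_unitCell h)
    (fun z _ => measurableSet_unitCell z)]
  simp [volume_unitCell]

lemma norm_sub_le_of_mem_unitCell {z : ℤ × ℤ} {p : ℂ} (h : p ∈ unitCell z) :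
    ‖p - ⟨z.1, z.2⟩‖ ≤ 1 := by
  rw [mem_unitCell] at h
  rw [Complex.norm_def, Complex.normSq_apply, Real.sqrt_le_one]
  simp only [Complex.sub_re, Complex.sub_im]
  nlinarith

lemma norm_latPoint (z : ℤ × ℤ) : ‖(⟨z.1, z.2⟩ : ℂ)‖ = √(latSq z) := by
  rw [Complex.norm_def, Complex.normSq_apply]
  unfold latSq
  ring_nf

lemma exists_mem_unitCell (p : ℂ) : ∃ z, p ∈ unitCell z := by
  refine ⟨(⌊p.re + 1 / 2⌋, ⌊p.im + 1 / 2⌋), ?_⟩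
  rw [mem_unitCell]
  have := Int.floor_le (p.re + 1 / 2)
  have := Int.lt_floor_add_one (p.re + 1 / 2)
  have := Int.floor_le (p.im + 1 / 2)
  have := Int.lt_floor_add_one (p.im + 1 / 2)
  refine ⟨⟨?_, ?_⟩, ?_, ?_⟩ <;> linarith

/-- A quantitative Gauss circle estimate. -/
lemma abs_card_latDisc_sub_le (K : ℕ) :
    |((latDisc K).card : ℝ) - π * K| ≤ π * (2 * √K + 1) := by
  have hK : (0 : ℝ) ≤ K := Nat.cast_nonneg K
  have hs := Real.sq_sqrt hK
  have hs0 := Real.sqrt_nonneg (K : ℝ)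
  have hvol := volume_iUnion_unitCell (latDisc K)
  have hball : ∀ r : ℝ, 0 ≤ r → volume (Metric.closedBall (0 : ℂ) r) = ENNReal.ofReal (π * r ^ 2) := by
    intro r hr
    rw [Complex.volume_closedBall, mul_comm, ENNReal.ofReal_mul Real.pi_pos.le,
      ENNReal.ofReal_pow hr]
    congr 1
    rw [ENNReal.ofReal, Real.toNNReal_of_nonneg Real.pi_pos.le]; rfl
  have hcard : ((latDisc K).card : ENNReal) = ENNReal.ofReal ((latDisc K).card : ℝ) := by simp
  have upper : ((latDisc K).card : ℝ) ≤ π * (√K + 1) ^ 2 := by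
    have hsub : (⋃ z ∈ latDisc K, unitCell z) ⊆ Metric.closedBall (0 : ℂ) (√K + 1) := by
      intro p hp
      simp only [Set.mem_iUnion] at hp
      obtain ⟨z, hz, hpz⟩ := hp
      rw [mem_closedBall_zero_iff]
      have h1 := norm_sub_le_of_mem_unitCell hpz
      have h2 : ‖(⟨z.1, z.2⟩ : ℂ)‖ ≤ √K := by
        rw [norm_latPoint]; exact Real.sqrt_le_sqrt (mem_latDisc.1 hz)
      have h3 := norm_le_norm_add_norm_sub (⟨z.1, z.2⟩ : ℂ) p
      rw [norm_sub_rev] at h3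
      linarith
    have := measure_mono (μ := volume) hsub
    rw [hvol, hball _ (by positivity), hcard,
      ENNReal.ofReal_le_ofReal_iff (by positivity)] at this
    exact this
  have lower : π * K - π * (2 * √K + 1) ≤ ((latDisc K).card : ℝ) := by
    rcases lt_or_ge (√(K : ℝ)) 1 with h | h
    · have : π * K - π * (2 * √K + 1) ≤ 0 := by
        have h2 : K - (2 * √K + 1) ≤ (0 : ℝ) := by nlinarith
        have := mul_nonpos_of_nonneg_of_nonpos Real.pi_pos.le h2
        linarith
      exact this.trans (Nat.cast_nonneg _)
    · have hsub : Metric.closedBall (0 : ℂ) (√K - 1) ⊆ (⋃ z ∈ latDisc K, unitCell z) := by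
        intro p hp
        rw [mem_closedBall_zero_iff] at hp
        obtain ⟨z, hz⟩ := exists_mem_unitCell p
        simp only [Set.mem_iUnion]
        refine ⟨z, ?_, hz⟩
        have h1 := norm_sub_le_of_mem_unitCell hz
        have h3 := norm_le_norm_add_norm_sub p (⟨z.1, z.2⟩ : ℂ)
        rw [norm_latPoint] at h3
        rw [mem_latDisc]
        have : √(latSq z) ≤ √K := by linarith
        exact (Real.sqrt_le_sqrt_iff hK).1 this
      have := measure_mono (μ := volume) hsub
      rw [hvol, hball _ (by linarith), hcard,
        ENNReal.ofReal_le_ofReal_iff (by positivity)] at this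
      have := Real.pi_pos
      nlinarith
  rw [abs_le]
  constructor
  · linarith
  · nlinarith

lemma latDisc_succ_sum (f : ℝ → ℝ) (K : ℕ) :
    ∑ z ∈ latDisc (K + 1), f (latSq z) = ∑ z ∈ latDisc K, f (latSq z)
      + (((latDisc (K + 1)).card : ℝ) - (latDisc K).card) * f ((K : ℝ) + 1) := by
  have hsub : latDisc K ⊆ latDisc (K + 1) := by
    intro z hz
    rw [mem_latDisc_iff] at hz ⊢
    push_cast; linarith
  rw [← Finset.sum_sdiff hsub, add_comm]
  congr 1
  have hc : (((latDisc (K + 1)).card : ℝ) - (latDisc K).card)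
      = ((latDisc (K + 1) \ latDisc K).card : ℝ) := by
    rw [Finset.card_sdiff_of_subset hsub, Nat.cast_sub (Finset.card_le_card hsub)]
  rw [hc, ← nsmul_eq_mul]
  refine Finset.sum_eq_card_nsmul fun z hz => ?_
  rw [Finset.mem_sdiff, mem_latDisc_iff, mem_latDisc_iff] at hz
  have h1 : z.1 ^ 2 + z.2 ^ 2 = (K : ℤ) + 1 := by
    have := hz.1
    push_cast at this
    omega
  congr 1
  unfold latSq
  exact_mod_cast h1

/-- Summation by parts comparing a radial lattice sum with its continuous counterpart. -/
lemma sum_latDisc_sub (f : ℝ → ℝ) (K : ℕ) :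
    ∑ z ∈ latDisc K, f (latSq z) - π * ∑ n ∈ Finset.range K, f ((n : ℝ) + 1)
      = (((latDisc K).card : ℝ) - π * K) * f K
        + ∑ n ∈ Finset.range K, (((latDisc n).card : ℝ) - π * n) * (f n - f ((n : ℝ) + 1)) := by
  induction K with
  | zero =>
    have h : ∀ z ∈ latDisc 0, f (latSq z) = f 0 := by
      intro z hz
      have := mem_latDisc.1 hz
      have h2 := latSq_nonneg z
      congr 1
      exact le_antisymm (by simpa using this) h2
    rw [Finset.sum_eq_card_nsmul h]
    simp
  | succ K ih =>
    rw [latDisc_succ_sum, Finset.sum_range_succ, Finset.sum_range_succ]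
    push_cast
    linarith

lemma abs_sum_latDisc_sub_le {f : ℝ → ℝ} (hf0 : ∀ n : ℕ, 0 ≤ f n)
    (hanti : ∀ n : ℕ, f ((n : ℝ) + 1) ≤ f n)
    (hf : ∀ n : ℕ, f ((n : ℝ) + 1) ≤ 1 / ((n : ℝ) + 1)) (K : ℕ) :
    |∑ z ∈ latDisc K, f (latSq z) - π * ∑ n ∈ Finset.range K, f ((n : ℝ) + 1)|
      ≤ π * (f 0 + 4) := by
  have W : ∀ K : ℕ, (2 * √(K : ℝ) + 1) * f K
      + ∑ n ∈ Finset.range K, (2 * √(n : ℝ) + 1) * (f n - f ((n : ℝ) + 1)) ≤ f 0 + 4 := by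
    have W1 : ∀ K : ℕ, (2 * √((K : ℝ) + 1) + 1) * f ((K : ℝ) + 1)
      + ∑ n ∈ Finset.range (K + 1), (2 * √(n : ℝ) + 1) * (f n - f ((n : ℝ) + 1))
        ≤ f 0 + 4 - 2 / √((K : ℝ) + 1) := by
      intro K
      induction K with
      | zero =>
        have := hf 0
        simp at this ⊢
        linarith
      | succ K ih =>
        rw [Finset.sum_range_succ]
        push_cast at ih ⊢
        have hK : (0 : ℝ) ≤ K := Nat.cast_nonneg K
        have hf' := hf (K + 1)
        push_cast at hf'
        have ea := Real.sq_sqrt (show (0 : ℝ) ≤ K + 1 by positivity)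
        have eb := Real.sq_sqrt (show (0 : ℝ) ≤ K + 1 + 1 by positivity)
        have ha : 0 < √((K : ℝ) + 1) := Real.sqrt_pos.2 (by positivity)
        have hab : √((K : ℝ) + 1) ≤ √((K : ℝ) + 1 + 1) := Real.sqrt_le_sqrt (by linarith)
        set a := √((K : ℝ) + 1)
        set b := √((K : ℝ) + 1 + 1)
        have hb : 0 < b := ha.trans_le hab
        have h1 : 2 * (b - a) * f ((K : ℝ) + 1 + 1) ≤ 2 / a - 2 / b := by
          calc 2 * (b - a) * f ((K : ℝ) + 1 + 1) ≤ 2 * (b - a) * (1 / b ^ 2) := by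
                refine mul_le_mul_of_nonneg_left ?_ (by linarith)
                rw [eb]; exact hf'
            _ ≤ 2 * (b - a) * (1 / (a * b)) := by
                refine mul_le_mul_of_nonneg_left ?_ (by linarith)
                exact one_div_le_one_div_of_le (by positivity) (by nlinarith)
            _ = 2 / a - 2 / b := by field_simp
        linarith
    intro K
    rcases K with _ | K
    · simp
    · refine le_trans (by exact_mod_cast W1 K) ?_
      have : 0 ≤ 2 / √((K + 1 : ℕ) : ℝ) := by positivity
      linarith
  rw [sum_latDisc_sub]
  calc _ ≤ |(((latDisc K).card : ℝ) - π * K) * f K|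
        + ∑ n ∈ Finset.range K,
          |(((latDisc n).card : ℝ) - π * n) * (f n - f ((n : ℝ) + 1))| :=
        (abs_add_le _ _).trans (add_le_add le_rfl (Finset.abs_sum_le_sum_abs _ _))
    _ ≤ π * (2 * √K + 1) * f K
        + ∑ n ∈ Finset.range K, π * (2 * √n + 1) * (f n - f ((n : ℝ) + 1)) := by
        refine add_le_add ?_ (Finset.sum_le_sum fun n _ => ?_)
        · rw [abs_mul, abs_of_nonneg (hf0 K)]
          exact mul_le_mul_of_nonneg_right (abs_card_latDisc_sub_le K) (hf0 K)
        · have h := sub_nonneg.2 (hanti n)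
          rw [abs_mul, abs_of_nonneg h]
          exact mul_le_mul_of_nonneg_right (abs_card_latDisc_sub_le n) h
    _ = π * ((2 * √(K : ℝ) + 1) * f K
      + ∑ n ∈ Finset.range K, (2 * √(n : ℝ) + 1) * (f n - f ((n : ℝ) + 1))) := by
        simp only [mul_add π _ (Finset.sum _ _), Finset.mul_sum, mul_assoc]
    _ ≤ _ := mul_le_mul_of_nonneg_left (W K) Real.pi_pos.le

lemma sum_range_one_div_affine {m b : ℝ} (hm : 0 < m) (hb : 0 < b) (K : ℕ) :
    (1 / m) * (Real.log (m * K + b) - Real.log b) - 1 / b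
        ≤ ∑ n ∈ Finset.range K, 1 / (m * ((n : ℝ) + 1) + b) ∧
      ∑ n ∈ Finset.range K, 1 / (m * ((n : ℝ) + 1) + b)
        ≤ (1 / m) * (Real.log (m * K + b) - Real.log b) := by
  have step : ∀ n : ℕ, 1 / (m * ((n : ℝ) + 1) + b)
        ≤ (1 / m) * (Real.log (m * ((n : ℝ) + 1) + b) - Real.log (m * n + b)) ∧
      (1 / m) * (Real.log (m * ((n : ℝ) + 1) + b) - Real.log (m * n + b))
        ≤ 1 / (m * n + b) := by
    intro n
    have h0 : 0 < m * (n : ℝ) + b := by positivity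
    have h1 : 0 < m * ((n : ℝ) + 1) + b := by positivity
    rw [← Real.log_div h1.ne' h0.ne']
    have l := Real.one_sub_inv_le_log_of_pos (div_pos h1 h0)
    have u := Real.log_le_sub_one_of_pos (div_pos h1 h0)
    constructor
    · calc 1 / (m * ((n : ℝ) + 1) + b)
          = (1 / m) * (1 - ((m * ((n : ℝ) + 1) + b) / (m * n + b))⁻¹) := by
            field_simp; ring
        _ ≤ _ := by gcongr
    · calc _ ≤ (1 / m) * ((m * ((n : ℝ) + 1) + b) / (m * n + b) - 1) := by gcongr
        _ = _ := by field_simp; ring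
  constructor
  · suffices h : (1 / m) * (Real.log (m * K + b) - Real.log b) - 1 / b + 1 / (m * K + b)
        ≤ ∑ n ∈ Finset.range K, 1 / (m * ((n : ℝ) + 1) + b) by
      have : 0 ≤ 1 / (m * K + b) := by positivity
      linarith
    induction K with
    | zero => simp
    | succ K ih =>
      rw [Finset.sum_range_succ]
      have := (step K).2
      push_cast
      linarith
  · induction K with
    | zero => simp
    | succ K ih =>
      rw [Finset.sum_range_succ]
      have := (step K).1
      push_cast
      linarith

lemma exists_abs_sum_latDisc_sub_log_le {m : ℝ} (hm : 1 ≤ m) :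
    ∃ C : ℝ, 0 < C ∧ ∀ R b : ℝ, 1 ≤ R → 1 / (4 * π ^ 2) ≤ b → b ≤ R →
      |∑ z ∈ latDisc ⌊R⌋₊, 1 / (m * latSq z + b) - π / m * Real.log (R / b)| ≤ C := by
  have hpi := Real.pi_pos
  have hm0 : 0 < m := by linarith
  have hl1 : 0 ≤ Real.log (m + 1) := Real.log_nonneg (by linarith)
  have hl2 : 0 ≤ Real.log 2 := Real.log_nonneg (by norm_num)
  refine ⟨π * (4 * π ^ 2 + 4) + π * (4 * π ^ 2 + Real.log (m + 1) + Real.log 2), by positivity,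
    fun R b hR hb hbR => ?_⟩
  have hb0 : 0 < b := lt_of_lt_of_le (by positivity) hb
  have hR0 : 0 < R := by linarith
  have hbi : 1 / b ≤ 4 * π ^ 2 := by
    rw [div_le_iff₀ (by positivity)] at hb
    rw [div_le_iff₀ hb0]; linarith
  set K := ⌊R⌋₊ with hK
  have hK1 : (1 : ℝ) ≤ K := by exact_mod_cast (Nat.le_floor (by exact_mod_cast hR) : 1 ≤ ⌊R⌋₊)
  have hKR : (K : ℝ) ≤ R := Nat.floor_le hR0.le
  have hRK : R < K + 1 := Nat.lt_floor_add_one R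
  have hsum := abs_sum_latDisc_sub_le (f := fun x => 1 / (m * x + b))
    (fun n => by positivity)
    (fun n => one_div_le_one_div_of_le (by positivity) (by nlinarith))
    (fun n => one_div_le_one_div_of_le (by positivity) (by nlinarith [n.cast_nonneg (α := ℝ)])) K
  obtain ⟨hl, hu⟩ := sum_range_one_div_affine hm0 hb0 K
  simp only [mul_zero, zero_add] at hsum
  have hlogu : Real.log (m * K + b) - Real.log b ≤ Real.log (R / b) + Real.log (m + 1) := by
    rw [Real.log_div hR0.ne' hb0.ne']
    have : Real.log (m * K + b) ≤ Real.log (R * (m + 1)) :=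
      Real.log_le_log (by positivity) (by nlinarith)
    rw [Real.log_mul hR0.ne' (by linarith)] at this
    linarith
  have hlogl : Real.log (R / b) - Real.log 2 ≤ Real.log (m * K + b) - Real.log b := by
    rw [Real.log_div hR0.ne' hb0.ne']
    have : Real.log R ≤ Real.log (2 * (m * K + b)) :=
      Real.log_le_log (by positivity) (by nlinarith)
    rw [Real.log_mul (by norm_num) (by positivity)] at this
    linarith
  set S := ∑ n ∈ Finset.range K, 1 / (m * ((n : ℝ) + 1) + b)
  set Λ := Real.log (R / b)
  have hm1 : 1 / m ≤ 1 := by rw [div_le_one hm0]; exact hm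
  have hm1' : 0 < 1 / m := by positivity
  have hS : |S - 1 / m * Λ| ≤ 4 * π ^ 2 + Real.log (m + 1) + Real.log 2 := by
    rw [abs_le]
    constructor
    · have := mul_le_mul_of_nonneg_left hlogl hm1'.le
      have := mul_le_mul_of_nonneg_right hm1 hl2
      linarith
    · have := mul_le_mul_of_nonneg_left hlogu hm1'.le
      have := mul_le_mul_of_nonneg_right hm1 hl1
      have : 0 ≤ 4 * π ^ 2 := by positivity
      linarith
  have e : ∑ z ∈ latDisc K, 1 / (m * latSq z + b) - π / m * Λ
      = (∑ z ∈ latDisc K, 1 / (m * latSq z + b) - π * S) + π * (S - 1 / m * Λ) := by ring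
  rw [e]
  refine (abs_add_le _ _).trans (add_le_add (hsum.trans ?_) ?_)
  · gcongr
  · rw [abs_mul, abs_of_pos hpi]
    gcongr

/-- The excitation energy appearing in `Gfun` for `e = 0`, in integer units. -/
noncomputable def excEnergy (M : ℝ) (q z : ℤ × ℤ) : ℝ :=
  1 / M * latSq (q - z) + latSq z - latSq q

lemma one_le_latSq_sub {q z : ℤ × ℤ} (h : latSq q < latSq z) : 1 ≤ latSq (q - z) := by
  have hne : q - z ≠ 0 := by
    intro h0
    rw [sub_eq_zero] at h0
    rw [h0] at h
    exact lt_irrefl _ h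
  have hpos : (0 : ℤ) < (q - z).1 ^ 2 + (q - z).2 ^ 2 := by
    by_contra hc
    apply hne
    have h1 : (q - z).1 ^ 2 = 0 := by nlinarith [sq_nonneg (q - z).1, sq_nonneg (q - z).2]
    have h2 : (q - z).2 ^ 2 = 0 := by nlinarith [sq_nonneg (q - z).1, sq_nonneg (q - z).2]
    exact Prod.ext (pow_eq_zero_iff two_ne_zero |>.1 h1) (pow_eq_zero_iff two_ne_zero |>.1 h2)
  have : (1 : ℤ) ≤ (q - z).1 ^ 2 + (q - z).2 ^ 2 := hpos
  unfold latSq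
  exact_mod_cast this

lemma excEnergy_pos {M : ℝ} (hM : 0 < M) {q z : ℤ × ℤ} (h : latSq q < latSq z) :
    0 < excEnergy M q z := by
  have h1 := one_le_latSq_sub h
  have : 0 < 1 / M * latSq (q - z) := by positivity
  unfold excEnergy; linarith

lemma sum_one_div_excEnergy_right_le {M ρ : ℝ} (hM : 0 < M) (hρ : 1 ≤ ρ) {q : ℤ × ℤ}
    (hq : latSq q ≤ ρ ^ 2) (hq1 : ρ / 3 ≤ q.1) (T : Finset (ℤ × ℤ))
    (hT : ∀ z ∈ T, ρ ^ 2 < latSq z ∧ latSq z ≤ 4 * ρ ^ 2 ∧ (q.1 : ℝ) / 2 ≤ z.1) :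
    ∑ z ∈ T, 1 / excEnergy M q z ≤ 25 * (2 * M + 6) := by
  classical
  have hρ0 : 0 < ρ := by linarith
  let a : ℤ × ℤ → ℝ := fun z => √(latSq q - (z.2 : ℝ) ^ 2)
  let ψ : ℤ × ℤ → ℕ × ℤ := fun z => ((z.1 - ⌊a z⌋ - 1).toNat, z.2 - q.2)
  let g : ℕ × ℤ → ℝ := fun p => 1 / ((p.2 : ℝ) ^ 2 + √(1 + p.1 * ρ) ^ 2)
  have hpos : ∀ z ∈ T, 0 ≤ z.1 - ⌊a z⌋ - 1 ∧ a z < z.1 := by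
    intro z hz
    obtain ⟨h1, h2, h3⟩ := hT z hz
    have hz1 : (0 : ℝ) < z.1 := by linarith
    have ha : a z < z.1 := by
      refine (Real.sqrt_lt' hz1).2 ?_
      unfold latSq at *; linarith
    have : ⌊a z⌋ < z.1 := Int.floor_lt.2 ha
    exact ⟨by omega, ha⟩
  have hjle : ∀ z ∈ T, ((ψ z).1 : ℝ) ≤ z.1 - a z := by
    intro z hz
    obtain ⟨h1, h2⟩ := hpos z hz
    have e : (((ψ z).1 : ℤ) : ℝ) = ((z.1 - ⌊a z⌋ - 1 : ℤ) : ℝ) := by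
      exact_mod_cast Int.toNat_of_nonneg h1
    have := Int.lt_floor_add_one (a z)
    push_cast at e
    linarith
  have hinj : Set.InjOn ψ T := by
    intro z hz w hw h
    have h1 := (hpos z hz).1
    have h2 := (hpos w hw).1
    simp only [ψ, Prod.mk.injEq] at h
    have hs : z.2 = w.2 := by omega
    have ha : a z = a w := by simp only [a, hs]
    rw [ha] at h h1
    refine Prod.ext ?_ hs
    omega
  have hbound : ∀ z ∈ T, 1 / excEnergy M q z ≤ (2 * M + 6) * g (ψ z) := by
    intro z hz
    obtain ⟨h1, h2, h3⟩ := hT z hz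
    have hone := one_le_latSq_sub (hq.trans_lt h1)
    obtain ⟨-, haz⟩ := hpos z hz
    have hj := hjle z hz
    have ha0 : 0 ≤ a z := Real.sqrt_nonneg _
    have hsq : latSq q - (z.2 : ℝ) ^ 2 ≤ a z ^ 2 := by
      rcases le_total 0 (latSq q - (z.2 : ℝ) ^ 2) with h | h
      · exact (Real.sq_sqrt h).ge
      · exact h.trans (sq_nonneg _)
    have hz1 : ρ / 6 ≤ z.1 := by linarith
    have hj0 : (0 : ℝ) ≤ ((ψ z).1 : ℝ) := Nat.cast_nonneg _
    have hn : ((ψ z).2 : ℝ) ^ 2 ≤ latSq (q - z) := by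
      simp only [ψ, latSq, Prod.fst_sub, Prod.snd_sub]
      push_cast
      nlinarith [sq_nonneg ((q.1 : ℝ) - z.1)]
    have hgap : ((ψ z).1 : ℝ) * (ρ / 6) ≤ latSq z - latSq q := by
      have : ((ψ z).1 : ℝ) * (ρ / 6) ≤ (z.1 - a z) * (z.1 + a z) :=
        mul_le_mul hj (by linarith) (by positivity) (by linarith)
      unfold latSq at *
      nlinarith
    have hs : √(1 + ((ψ z).1 : ℝ) * ρ) ^ 2 = 1 + ((ψ z).1 : ℝ) * ρ :=
      Real.sq_sqrt (by positivity)
    have hpos' := excEnergy_pos hM (hq.trans_lt h1)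
    simp only [g]
    rw [hs, mul_one_div, div_le_div_iff₀ hpos' (by positivity), one_mul]
    have e : (2 * M + 6) * excEnergy M q z
        = 2 * latSq (q - z) + 6 * (1 / M * latSq (q - z))
          + (2 * M + 6) * (latSq z - latSq q) := by
      unfold excEnergy; field_simp; ring
    rw [e]
    have h6 : 0 ≤ 6 * (1 / M * latSq (q - z)) := by
      have := latSq_nonneg (q - z); positivity
    have h7 : 6 * (((ψ z).1 : ℝ) * (ρ / 6)) ≤ (2 * M + 6) * (latSq z - latSq q) :=
      mul_le_mul (by linarith) hgap (by positivity) (by linarith)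
    linarith
  refine (Finset.sum_le_sum hbound).trans ?_
  rw [← Finset.mul_sum, mul_comm]
  refine mul_le_mul_of_nonneg_right ?_ (by linarith)
  rw [← Finset.sum_image (f := g) hinj]
  obtain ⟨B, hB⟩ : ∃ B : ℕ, ∀ p ∈ T.image ψ, p.2.natAbs ≤ B :=
    ⟨(T.image ψ).sup (fun p => p.2.natAbs),
      fun p hp => Finset.le_sup (f := fun p : ℕ × ℤ => p.2.natAbs) hp⟩
  have hsub : T.image ψ ⊆
      Finset.range (⌊2 * ρ⌋₊ + 1) ×ˢ Finset.Icc (-(B : ℤ)) B := by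
    intro p hp
    have hb := hB p hp
    obtain ⟨z, hz, rfl⟩ := Finset.mem_image.1 hp
    rw [Finset.mem_product, Finset.mem_range, Finset.mem_Icc]
    refine ⟨Nat.lt_succ_of_le (Nat.le_floor ?_), by omega, by omega⟩
    have h1 := hjle z hz
    have h2 : 0 ≤ a z := Real.sqrt_nonneg _
    have h3 : (z.1 : ℝ) ≤ 2 * ρ := by
      refine abs_le_of_sq_le_sq' ?_ (by linarith) |>.2
      have := (hT z hz).2.1
      unfold latSq at this
      nlinarith [sq_nonneg (z.2 : ℝ)]
    linarith
  refine (Finset.sum_le_sum_of_subset_of_nonneg hsub fun p _ _ => by positivity).trans ?_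
  rw [Finset.sum_product]
  have hin : ∀ j ∈ Finset.range (⌊2 * ρ⌋₊ + 1),
      ∑ n ∈ Finset.Icc (-(B : ℤ)) B, g (j, n) ≤ 5 * (1 / √(1 + j * ρ)) := by
    intro j _
    rw [mul_one_div]
    refine sum_Icc_one_div_sq_add_le (A := √(1 + j * ρ)) ?_ B
    rw [Real.one_le_sqrt]
    have : 0 ≤ (j : ℝ) * ρ := by positivity
    linarith
  refine (Finset.sum_le_sum hin).trans ?_
  rw [← Finset.mul_sum]
  have h1 := sum_range_one_div_sqrt_le hρ0 ⌊2 * ρ⌋₊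
  have h2 : √((⌊2 * ρ⌋₊ : ℝ) / ρ) ≤ 2 := by
    rw [Real.sqrt_le_left (by norm_num), div_le_iff₀ hρ0]
    have := Nat.floor_le (show 0 ≤ 2 * ρ by linarith)
    linarith
  linarith

lemma sum_one_div_excEnergy_sector_le {M ρ : ℝ} (hM : 0 < M) (hρ : 1 ≤ ρ) {q : ℤ × ℤ}
    (hq : latSq q ≤ ρ ^ 2) (hq12 : |(q.2 : ℝ)| ≤ q.1) (T : Finset (ℤ × ℤ))
    (hT : ∀ z ∈ T, ρ ^ 2 < latSq z ∧ latSq z ≤ 4 * ρ ^ 2) :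
    ∑ z ∈ T, 1 / excEnergy M q z ≤ 25 * (2 * M + 6) + (36 * M + 2) * 576 := by
  classical
  have hρ0 : 0 < ρ := by linarith
  have hq1 : (0 : ℝ) ≤ q.1 := (abs_nonneg _).trans hq12
  have hq2 : (q.2 : ℝ) ^ 2 ≤ (q.1 : ℝ) ^ 2 := sq_le_sq' (by linarith [neg_abs_le (q.2 : ℝ)])
    ((le_abs_self _).trans hq12)
  let P : ℤ × ℤ → Prop := fun z => ρ ^ 2 / 4 < latSq q ∧ (q.1 : ℝ) / 2 ≤ z.1
  rw [← Finset.sum_filter_add_sum_filter_not T P]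
  refine add_le_add ?_ ?_
  · by_cases h : ρ ^ 2 / 4 < latSq q
    · refine sum_one_div_excEnergy_right_le hM hρ hq ?_ _ fun z hz => ?_
      · unfold latSq at h
        by_contra hc
        push Not at hc
        nlinarith
      · obtain ⟨hz, hP⟩ := Finset.mem_filter.1 hz
        exact ⟨(hT z hz).1, (hT z hz).2, hP.2⟩
    · rw [Finset.filter_false_of_mem (fun z _ hP => h hP.1), Finset.sum_empty]
      positivity
  · have hb : ∀ z ∈ T.filter (fun z => ¬ P z),
        1 / excEnergy M q z ≤ (36 * M + 2) * 72 * radialWeight ρ z := by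
      intro z hz
      obtain ⟨hz, hP⟩ := Finset.mem_filter.1 hz
      obtain ⟨h1, h2⟩ := hT z hz
      have hw := (one_div_sq_le_radialWeight hρ0 h1 h2).2
      have hpos := excEnergy_pos hM (hq.trans_lt h1)
      have key : 1 / excEnergy M q z ≤ (36 * M + 2) * (1 / ρ ^ 2) := by
        rw [mul_one_div, div_le_div_iff₀ hpos (by positivity), one_mul]
        have hn := latSq_nonneg (q - z)
        have e : (36 * M + 2) * excEnergy M q z = 36 * latSq (q - z)
          + 2 * (1 / M * latSq (q - z)) + (36 * M + 2) * (latSq z - latSq q) := by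
          unfold excEnergy; field_simp; ring
        have h3 : 0 ≤ 2 * (1 / M * latSq (q - z)) := by positivity
        have h4 : 2 * (latSq z - latSq q) ≤ (36 * M + 2) * (latSq z - latSq q) :=
          mul_le_mul_of_nonneg_right (by linarith) (by linarith)
        rw [e]
        by_cases h : ρ ^ 2 / 4 < latSq q
        · have h5 : (z.1 : ℝ) < q.1 / 2 := by
            by_contra hc
            exact hP ⟨h, not_lt.1 hc⟩
          have h6 : (q.1 : ℝ) ^ 2 / 4 ≤ latSq (q - z) := by
            simp only [latSq, Prod.fst_sub, Prod.snd_sub]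
            push_cast
            nlinarith [sq_nonneg ((q.2 : ℝ) - z.2)]
          have h7 : ρ ^ 2 / 8 ≤ (q.1 : ℝ) ^ 2 := by
            unfold latSq at h; linarith
          nlinarith
        · push Not at h
          linarith
      calc _ ≤ _ := key
        _ ≤ (36 * M + 2) * (72 * radialWeight ρ z) :=
          mul_le_mul_of_nonneg_left hw (by linarith)
        _ = _ := by ring
    refine (Finset.sum_le_sum hb).trans ?_
    rw [← Finset.mul_sum]
    have := mul_le_mul_of_nonneg_left
      (sum_radialWeight_le hρ0 (T.filter (fun z => ¬ P z))) (show 0 ≤ (36 * M + 2) * 72 by linarith)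
    linarith

/-- The lattice sum of inverse excitation energies over a shell outside the Fermi disc is bounded
uniformly in the radius. -/
lemma sum_one_div_excEnergy_le {M ρ : ℝ} (hM : 0 < M) (hρ : 1 ≤ ρ) {q : ℤ × ℤ}
    (hq : latSq q ≤ ρ ^ 2) (T : Finset (ℤ × ℤ))
    (hT : ∀ z ∈ T, ρ ^ 2 < latSq z ∧ latSq z ≤ 4 * ρ ^ 2) :
    ∑ z ∈ T, 1 / excEnergy M q z ≤ 25 * (2 * M + 6) + (36 * M + 2) * 576 := by
  classical
  have transfer : ∀ (σ : ℤ × ℤ → ℤ × ℤ), Function.Injective σ → (∀ z, latSq (σ z) = latSq z) →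
      (∀ z w, latSq (σ z - σ w) = latSq (z - w)) → |((σ q).2 : ℝ)| ≤ (σ q).1 →
      ∑ z ∈ T, 1 / excEnergy M q z ≤ 25 * (2 * M + 6) + (36 * M + 2) * 576 := by
    intro σ hσ h1 h2 h3
    have := sum_one_div_excEnergy_sector_le hM hρ (q := σ q) (by rwa [h1]) h3 (T.image σ)
      (by
        intro w hw
        obtain ⟨z, hz, rfl⟩ := Finset.mem_image.1 hw
        rw [h1]; exact hT z hz)
    rw [Finset.sum_image fun _ _ _ _ h => hσ h] at this
    simpa only [excEnergy, h1, h2] using this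
  rcases le_total |(q.2 : ℝ)| |(q.1 : ℝ)| with h | h
  · rcases le_total 0 (q.1 : ℝ) with h0 | h0
    · rw [abs_of_nonneg h0] at h
      exact sum_one_div_excEnergy_sector_le hM hρ hq h T hT
    · rw [abs_of_nonpos h0] at h
      refine transfer (fun z => (-z.1, z.2)) (fun z w h => ?_) (fun z => ?_) (fun z w => ?_) ?_
      · simp only [Prod.mk.injEq, neg_inj] at h
        exact Prod.ext h.1 h.2
      · simp [latSq]
      · simp only [latSq, Prod.fst_sub, Prod.snd_sub]; push_cast; ring
      · simpa using h
  · rcases le_total 0 (q.2 : ℝ) with h0 | h0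
    · rw [abs_of_nonneg h0] at h
      refine transfer Prod.swap Prod.swap_injective (fun z => ?_) (fun z w => ?_) ?_
      · simp only [latSq, Prod.fst_swap, Prod.snd_swap]; ring
      · simp only [latSq, Prod.fst_sub, Prod.snd_sub, Prod.fst_swap, Prod.snd_swap]; ring
      · simpa using h
    · rw [abs_of_nonpos h0] at h
      refine transfer (fun z => (-z.2, z.1)) (fun z w h => ?_) (fun z => ?_) (fun z w => ?_) ?_
      · simp only [Prod.mk.injEq, neg_inj] at h
        exact Prod.ext h.2 h.1
      · simp only [latSq]; push_cast; ring
      · simp only [latSq, Prod.fst_sub, Prod.snd_sub]; push_cast; ring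
      · simpa using h

/-- The summand of `Gfun` outside the Fermi disc, in integer units. -/
noncomputable def outerTerm (M b : ℝ) (q : ℤ × ℤ) (ε : ℝ) (z : ℤ × ℤ) : ℝ :=
  1 / ((1 + 1 / M) * latSq z + b) - 1 / (excEnergy M q z + ε)

/-- The majorant of `outerTerm`. -/
noncomputable def outerBound (M ρ : ℝ) (q z : ℤ × ℤ) : ℝ :=
  (72 / M + 48) * radialWeight ρ z + if latSq z ≤ 4 * ρ ^ 2 then 1 / excEnergy M q z else 0

lemma outerBound_nonneg {M ρ : ℝ} (hM : 0 < M) (hρ : 0 < ρ) {q z : ℤ × ℤ}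
    (hqz : latSq q < latSq z) : 0 ≤ outerBound M ρ q z := by
  have h1 := radialWeight_nonneg hρ z
  have h2 := excEnergy_pos hM hqz
  unfold outerBound
  split_ifs <;> positivity

lemma abs_outerTerm_zero_le {M ρ b : ℝ} (hM : 0 < M) (hρ : 1 ≤ ρ) (hb : 0 < b) (hbρ : b ≤ ρ ^ 2)
    {q z : ℤ × ℤ} (hq : latSq q ≤ ρ ^ 2) (hz : 4 * ρ ^ 2 < latSq z) :
    |outerTerm M b q 0 z| ≤ (72 / M + 48) * radialWeight ρ z := by
  have hρ0 : 0 < ρ := by linarith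
  have hz' : ρ ^ 2 < latSq z := by nlinarith
  obtain ⟨hk1, hk2⟩ := latSup_pos_of_lt hρ0 hz'
  have hw := div_cube_le_radialWeight hρ0 hz'
  have hks := latSup_sq_le z
  have hpos := excEnergy_pos hM (hq.trans_lt hz')
  have hz1 := abs_fst_le_latSup z
  have hz2 := abs_snd_le_latSup z
  have hq0 := latSq_nonneg q
  have hqz0 := latSq_nonneg (q - z)
  have hMi : 0 < 1 / M := by positivity
  have hD : 3 / 4 * latSq z ≤ excEnergy M q z := by
    have : 0 ≤ 1 / M * latSq (q - z) := by positivity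
    unfold excEnergy; linarith
  have hq1 : |(q.1 : ℝ)| ≤ ρ := by
    refine abs_le_of_sq_le_sq ?_ hρ0.le
    unfold latSq at hq; nlinarith [sq_nonneg (q.2 : ℝ)]
  have hq2 : |(q.2 : ℝ)| ≤ ρ := by
    refine abs_le_of_sq_le_sq ?_ hρ0.le
    unfold latSq at hq; nlinarith [sq_nonneg (q.1 : ℝ)]
  have e : excEnergy M q z - ((1 + 1 / M) * latSq z + b)
      = 1 / M * (latSq q - 2 * (q.1 * z.1 + q.2 * z.2)) - latSq q - b := by
    simp only [excEnergy, latSq, Prod.fst_sub, Prod.snd_sub]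
    push_cast
    ring
  set k : ℝ := ((latSup z : ℕ) : ℝ)
  set s := latSq z
  set D := excEnergy M q z
  have hdot : |(q.1 : ℝ) * z.1 + q.2 * z.2| ≤ 2 * (ρ * k) := by
    refine (abs_add_le _ _).trans ?_
    rw [abs_mul, abs_mul]
    have h1 := mul_le_mul hq1 hz1 (abs_nonneg _) hρ0.le
    have h2 := mul_le_mul hq2 hz2 (abs_nonneg _) hρ0.le
    linarith
  have hρk : ρ ^ 2 ≤ 2 * (ρ * k) := by nlinarith
  have hnum : |D - ((1 + 1 / M) * s + b)| ≤ (6 / M + 4) * (ρ * k) := by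
    rw [e]
    obtain ⟨d1, d2⟩ := abs_le.1 hdot
    have i1 : |latSq q - 2 * ((q.1 : ℝ) * z.1 + q.2 * z.2)| ≤ 6 * (ρ * k) := by
      rw [abs_le]; constructor <;> linarith
    have i2 : |1 / M * (latSq q - 2 * ((q.1 : ℝ) * z.1 + q.2 * z.2))| ≤ 6 / M * (ρ * k) := by
      rw [abs_mul, abs_of_pos hMi]
      calc _ ≤ 1 / M * (6 * (ρ * k)) := by gcongr
        _ = _ := by ring
    obtain ⟨j1, j2⟩ := abs_le.1 i2
    rw [abs_le]; constructor <;> linarith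
  have hs0 : 0 < s := by nlinarith
  have hm : s ≤ (1 + 1 / M) * s + b := by nlinarith
  have hden : 3 / 4 * k ^ 4 ≤ ((1 + 1 / M) * s + b) * D := by
    calc 3 / 4 * k ^ 4 = k ^ 2 * (3 / 4 * k ^ 2) := by ring
      _ ≤ ((1 + 1 / M) * s + b) * D :=
        mul_le_mul (by linarith) (by linarith) (by positivity) (by linarith)
  have hm0 : 0 < (1 + 1 / M) * s + b := by linarith
  have eu : outerTerm M b q 0 z
      = (D - ((1 + 1 / M) * s + b)) / (((1 + 1 / M) * s + b) * D) := by
    unfold outerTerm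
    rw [add_zero, div_sub_div _ _ hm0.ne' hpos.ne', one_mul, mul_one]
  rw [eu, abs_div, abs_of_pos (mul_pos hm0 hpos)]
  calc _ ≤ (6 / M + 4) * (ρ * k) / (3 / 4 * k ^ 4) := by
        gcongr
    _ = (8 / M + 16 / 3) * (ρ / k ^ 3) := by field_simp; ring
    _ ≤ (8 / M + 16 / 3) * (9 * radialWeight ρ z) := by gcongr
    _ = _ := by ring

lemma outerTerm_bounds {M ρ b ε : ℝ} (hM : 0 < M) (hρ : 1 ≤ ρ) (hb : 0 < b) (hbρ : b ≤ ρ ^ 2)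
    (hε : 0 ≤ ε) {q z : ℤ × ℤ} (hq : latSq q ≤ ρ ^ 2) (hz : ρ ^ 2 < latSq z) :
    -outerBound M ρ q z ≤ outerTerm M b q ε z ∧
      outerTerm M b q ε z ≤ (1 + ε / ρ ^ 2) * outerBound M ρ q z := by
  have hρ0 : 0 < ρ := by linarith
  have hMi : 0 < 1 / M := by positivity
  have hw0 := radialWeight_nonneg hρ0 z
  have hpos := excEnergy_pos hM (hq.trans_lt hz)
  have hle : 1 / (excEnergy M q z + ε) ≤ 1 / excEnergy M q z :=
    one_div_le_one_div_of_le hpos (by linarith)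
  have hks := latSup_sq_le z
  obtain ⟨hk1, hk2⟩ := latSup_pos_of_lt hρ0 hz
  have hs0 : 0 < latSq z := by nlinarith
  have hm : latSq z ≤ (1 + 1 / M) * latSq z + b := by nlinarith
  have hr : 0 ≤ ε / ρ ^ 2 := by positivity
  rcases le_or_gt (latSq z) (4 * ρ ^ 2) with h | h
  · have hA : 0 ≤ 72 / M * radialWeight ρ z := by positivity
    have h18 := (one_div_sq_le_radialWeight hρ0 hz h).1
    have hD : 0 ≤ 1 / excEnergy M q z := by positivity
    have hD' : 0 ≤ 1 / (excEnergy M q z + ε) := by positivity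
    have hB : 18 * radialWeight ρ z ≤ outerBound M ρ q z := by
      unfold outerBound; rw [if_pos h]; linarith
    have hB' : 1 / excEnergy M q z ≤ outerBound M ρ q z := by
      unfold outerBound; rw [if_pos h]; linarith
    have hp : 0 ≤ 1 / ((1 + 1 / M) * latSq z + b) := by positivity
    have hp' : 1 / ((1 + 1 / M) * latSq z + b) ≤ 1 / ((latSup z : ℕ) : ℝ) ^ 2 :=
      one_div_le_one_div_of_le (by positivity) (by linarith)
    have hrB : 0 ≤ ε / ρ ^ 2 * outerBound M ρ q z := mul_nonneg hr (by linarith)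
    unfold outerTerm
    constructor <;> linarith
  · have h0 := abs_le.1 (abs_outerTerm_zero_le hM hρ hb hbρ hq h)
    have hB : outerBound M ρ q z = (72 / M + 48) * radialWeight ρ z := by
      unfold outerBound; rw [if_neg (not_le.2 h), add_zero]
    have e : outerTerm M b q ε z = outerTerm M b q 0 z
        + (1 / excEnergy M q z - 1 / (excEnergy M q z + ε)) := by
      unfold outerTerm; rw [add_zero]; ring
    have hD : 3 / 4 * latSq z ≤ excEnergy M q z := by
      have : 0 ≤ 1 / M * latSq (q - z) := mul_nonneg hMi.le (latSq_nonneg _)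
      unfold excEnergy; linarith
    have hw := div_cube_le_radialWeight hρ0 hz
    have hextra : 1 / excEnergy M q z - 1 / (excEnergy M q z + ε)
        ≤ ε / ρ ^ 2 * (36 * radialWeight ρ z) := by
      set k : ℝ := ((latSup z : ℕ) : ℝ)
      set D := excEnergy M q z
      have hk0 : 0 < k := by linarith
      have hkD : 3 / 4 * k ^ 2 ≤ D := by linarith
      calc 1 / D - 1 / (D + ε) = ε / (D * (D + ε)) := by
            field_simp; ring
        _ ≤ ε / ((3 / 4 * k ^ 2) * (3 / 4 * k ^ 2)) := by
            gcongr; linarith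
        _ = ε / ρ ^ 2 * (16 / 9 * (ρ / k) * (ρ / k ^ 3)) := by field_simp; ring
        _ ≤ ε / ρ ^ 2 * (16 / 9 * 2 * (9 * radialWeight ρ z)) := by
            have : ρ / k ≤ 2 := by rw [div_le_iff₀ hk0]; exact hk2
            gcongr
        _ ≤ ε / ρ ^ 2 * (36 * radialWeight ρ z) := by
            refine mul_le_mul_of_nonneg_left ?_ hr
            linarith
    have h36 : ε / ρ ^ 2 * (36 * radialWeight ρ z)
        ≤ ε / ρ ^ 2 * ((72 / M + 48) * radialWeight ρ z) := by
      have : 0 ≤ 72 / M * radialWeight ρ z := by positivity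
      refine mul_le_mul_of_nonneg_left ?_ hr
      linarith
    rw [hB, e]
    have : 0 ≤ 1 / excEnergy M q z - 1 / (excEnergy M q z + ε) := by linarith
    constructor <;> linarith

/-- `Gfun` in integer units, up to the factor `1 / (4π²)`. -/
noncomputable def latG (M R b : ℝ) (q : ℤ × ℤ) (ε : ℝ) : ℝ :=
  ∑' z : ℤ × ℤ, (1 / ((1 + 1 / M) * latSq z + b)
    - (if R < latSq z then 1 else 0) / (excEnergy M q z + ε))

lemma exists_latG_bounds {M : ℝ} (hM : 0 < M) :
    ∃ C : ℝ, 0 < C ∧ ∀ (R b ε : ℝ) (q : ℤ × ℤ), 1 ≤ R → 1 / (4 * π ^ 2) ≤ b → b ≤ R →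
      0 ≤ ε → latSq q ≤ R →
      π / (1 + 1 / M) * Real.log (R / b) - C ≤ latG M R b q ε ∧
      (ε ≤ R → latG M R b q ε ≤ π / (1 + 1 / M) * Real.log (R / b) + C) := by
  have hMi : 0 < 1 / M := by positivity
  obtain ⟨C₁, hC₁, hlog⟩ := exists_abs_sum_latDisc_sub_log_le (m := 1 + 1 / M) (by linarith)
  set W : ℝ := (72 / M + 48) * 8 + (25 * (2 * M + 6) + (36 * M + 2) * 576) with hWdef
  have hW : 0 < W := by positivity
  refine ⟨C₁ + 2 * W, by positivity, fun R b ε q hR hb hbR hε hq => ?_⟩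
  obtain ⟨ρ, hρ, rfl⟩ : ∃ ρ : ℝ, 1 ≤ ρ ∧ R = ρ ^ 2 :=
    ⟨√R, Real.one_le_sqrt.2 hR, (Real.sq_sqrt (by linarith)).symm⟩
  have hρ0 : 0 < ρ := by linarith
  have hb0 : 0 < b := lt_of_lt_of_le (by positivity) hb
  have hL := abs_le.1 (hlog (ρ ^ 2) b hR hb hbR)
  let w : ℤ × ℤ → ℝ := fun z => if ρ ^ 2 < latSq z then outerBound M ρ q z else 0
  let u : ℤ × ℤ → ℝ := fun z => if ρ ^ 2 < latSq z then outerTerm M b q ε z else 0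
  let p : ℤ × ℤ → ℝ := fun z => if latSq z ≤ ρ ^ 2 then 1 / ((1 + 1 / M) * latSq z + b) else 0
  have hw0 : ∀ z, 0 ≤ w z := by
    intro z
    simp only [w]
    split_ifs with h
    · exact outerBound_nonneg hM hρ0 (hq.trans_lt h)
    · exact le_rfl
  have hwsum : ∀ s : Finset (ℤ × ℤ), ∑ z ∈ s, w z ≤ W := by
    intro s
    simp only [w]
    rw [← Finset.sum_filter]
    unfold outerBound
    rw [Finset.sum_add_distrib, ← Finset.mul_sum, ← Finset.sum_filter, Finset.filter_filter]
    refine add_le_add ?_ ?_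
    · exact mul_le_mul_of_nonneg_left (sum_radialWeight_le hρ0 _) (by positivity)
    · refine sum_one_div_excEnergy_le hM hρ hq _ fun z hz => ?_
      exact (Finset.mem_filter.1 hz).2
  have hws : Summable w := summable_of_sum_le hw0 hwsum
  have hwt : ∑' z, w z ≤ W := Real.tsum_le_of_sum_le hw0 hwsum
  have hr : 0 ≤ ε / ρ ^ 2 := by positivity
  have hul : ∀ z, -w z ≤ u z := by
    intro z
    simp only [w, u]
    split_ifs with h
    · exact (outerTerm_bounds hM hρ hb0 hbR hε hq h).1
    · simp
  have huu : ∀ z, u z ≤ (1 + ε / ρ ^ 2) * w z := by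
    intro z
    simp only [w, u]
    split_ifs with h
    · exact (outerTerm_bounds hM hρ hb0 hbR hε hq h).2
    · simp
  have hus : Summable u := by
    refine Summable.of_norm_bounded (hws.mul_left (1 + ε / ρ ^ 2)) fun z => ?_
    rw [Real.norm_eq_abs, abs_le]
    refine ⟨?_, huu z⟩
    have := mul_nonneg hr (hw0 z)
    linarith [hul z]
  have hp : HasSum p (∑ z ∈ latDisc ⌊ρ ^ 2⌋₊, 1 / ((1 + 1 / M) * latSq z + b)) := by
    have : ∑ z ∈ latDisc ⌊ρ ^ 2⌋₊, 1 / ((1 + 1 / M) * latSq z + b)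
        = ∑ z ∈ latDisc ⌊ρ ^ 2⌋₊, p z := by
      refine Finset.sum_congr rfl fun z hz => ?_
      simp only [p]
      rw [if_pos ((mem_latDisc_floor (by positivity)).1 hz)]
    rw [this]
    refine hasSum_sum_of_ne_finset_zero fun z hz => ?_
    simp only [p]
    rw [if_neg fun h => hz ((mem_latDisc_floor (by positivity)).2 h)]
  have hG : latG M (ρ ^ 2) b q ε
      = ∑ z ∈ latDisc ⌊ρ ^ 2⌋₊, 1 / ((1 + 1 / M) * latSq z + b) + ∑' z, u z := by
    rw [← (hp.add hus.hasSum).tsum_eq]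
    unfold latG
    refine tsum_congr fun z => ?_
    simp only [p, u, outerTerm]
    by_cases h : ρ ^ 2 < latSq z
    · rw [if_pos h, if_pos h, if_neg (not_le.2 h), zero_add]
    · rw [if_neg h, if_neg h, if_pos (not_lt.1 h), zero_div, sub_zero, add_zero]
  have hlow : -W ≤ ∑' z, u z := by
    have := hws.neg.tsum_le_tsum hul hus
    rw [tsum_neg] at this
    linarith
  rw [hG]
  refine ⟨by linarith [hL.1], fun hεR => ?_⟩
  have hup := hus.tsum_le_tsum huu (hws.mul_left (1 + ε / ρ ^ 2))
  rw [tsum_mul_left] at hup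
  have hr1 : ε / ρ ^ 2 ≤ 1 := by rwa [div_le_one (by positivity)]
  have hwt0 : 0 ≤ ∑' z, w z := tsum_nonneg hw0
  have : (1 + ε / ρ ^ 2) * ∑' z, w z ≤ 2 * W :=
    mul_le_mul (by linarith) hwt hwt0 (by norm_num)
  linarith [hL.2]

lemma abs_card_latDisc_floor_sub_le {R : ℝ} (hR : 1 ≤ R) :
    |((latDisc ⌊R⌋₊).card : ℝ) - π * R| ≤ 4 * π * √R := by
  have h := abs_le.1 (abs_card_latDisc_sub_le ⌊R⌋₊)
  have h1 := Nat.floor_le (show 0 ≤ R by linarith)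
  have h2 := Nat.lt_floor_add_one R
  have h3 : √(⌊R⌋₊ : ℝ) ≤ √R := Real.sqrt_le_sqrt h1
  have h4 : 1 ≤ √R := Real.one_le_sqrt.2 hR
  have hpi := Real.pi_pos
  rw [abs_le]
  constructor <;> nlinarith

/-- The polaron asymptotics in integer units. -/
lemma exists_abs_polaron_sub_le {M : ℝ} (hM : 0 < M) :
    ∃ c₀ C : ℝ, 0 < c₀ ∧ 0 < C ∧ ∀ R b ε : ℝ, 1 / (4 * π ^ 2) ≤ b → c₀ ≤ R / b → 0 < ε →
      ε = ∑ q ∈ latDisc ⌊R⌋₊, 1 / latG M R b q ε →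
      |ε - (1 + 1 / M) * R / Real.log (R / b)| ≤ C * R / Real.log (R / b) ^ 2 := by
  obtain ⟨C₁, hC₁, hG⟩ := exists_latG_bounds hM
  have hpi := Real.pi_pos
  have hMi : 0 < 1 / M := by positivity
  set m : ℝ := 1 + 1 / M with hm
  have hm1 : 1 ≤ m := by linarith
  have hm0 : 0 < m := by linarith
  set Λ₀ : ℝ := m / π * (2 * C₁ + 10 * π)
  refine ⟨Real.exp Λ₀ + 4 * π ^ 2 + 1, (10 * π * C₁ + 16 * π ^ 3) * (m / π) ^ 2,
    by positivity, by positivity, fun R b ε hb hc hε heq => ?_⟩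
  have hb0 : 0 < b := lt_of_lt_of_le (by positivity) hb
  have hexp := Real.exp_pos Λ₀
  have h4pi : 0 < 4 * π ^ 2 := by positivity
  have hRb : b ≤ R := by
    have : 1 ≤ R / b := by linarith
    rwa [le_div_iff₀ hb0, one_mul] at this
  have hR : 1 ≤ R := by
    have h1 : 4 * π ^ 2 ≤ R / b := by linarith
    rw [le_div_iff₀ hb0] at h1
    rw [div_le_iff₀ h4pi] at hb
    linarith
  have hR0 : 0 < R := by linarith
  have hRb0 : 0 < R / b := by positivity
  set Λ := Real.log (R / b) with hΛ
  have hΛ₀ : Λ₀ ≤ Λ := by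
    rw [hΛ, Real.le_log_iff_exp_le hRb0]; linarith
  set A := π / m * Λ with hA
  have hA₀ : 2 * C₁ + 10 * π ≤ A := by
    calc 2 * C₁ + 10 * π = π / m * Λ₀ := by simp only [Λ₀]; field_simp
      _ ≤ A := by rw [hA]; gcongr
  have hA0 : 0 < A := by linarith
  have hΛ0 : 0 < Λ := by
    have : 0 < π / m := by positivity
    exact pos_of_mul_pos_right hA0 this.le
  have hAR : A ≤ 4 * π ^ 2 * √R := by
    have h1 : R / b ≤ (2 * π * √R) ^ 2 := by
      rw [mul_pow, Real.sq_sqrt hR0.le, div_le_iff₀ hb0]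
      rw [div_le_iff₀ h4pi] at hb
      nlinarith
    have h2 : Λ ≤ 2 * (2 * π * √R) := by
      calc Λ ≤ Real.log ((2 * π * √R) ^ 2) := Real.log_le_log hRb0 h1
        _ = 2 * Real.log (2 * π * √R) := by rw [Real.log_pow]; norm_num
        _ ≤ 2 * (2 * π * √R) := by
          have := Real.log_le_self (show 0 ≤ 2 * π * √R by positivity)
          linarith
    have h3 : π / m ≤ π := div_le_self hpi.le hm1
    calc A ≤ π * (2 * (2 * π * √R)) := mul_le_mul h3 h2 hΛ0.le hpi.le
      _ = _ := by ring
  have hcard := abs_le.1 (abs_card_latDisc_floor_sub_le hR)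
  set N : ℝ := ((latDisc ⌊R⌋₊).card : ℝ) with hN
  have hsR : √R ≤ R := by
    rw [Real.sqrt_le_left hR0.le]; nlinarith
  have hN5 : N ≤ 5 * π * R := by nlinarith
  have hlow : ∀ q ∈ latDisc ⌊R⌋₊, A / 2 ≤ latG M R b q ε := by
    intro q hq
    have := (hG R b ε q hR hb hRb hε.le ((mem_latDisc_floor hR0.le).1 hq)).1
    linarith
  have hεR : ε ≤ R := by
    have h1 : ε ≤ N * (2 / A) := by
      rw [heq, hN, ← nsmul_eq_mul]
      refine Finset.sum_le_card_nsmul _ _ _ fun q hq => ?_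
      have := one_div_le_one_div_of_le (by positivity) (hlow q hq)
      rwa [one_div_div] at this
    have h2 : N * (2 / A) ≤ R := by
      rw [mul_div_assoc', div_le_iff₀ hA0]
      nlinarith
    linarith
  have hsum : |ε - N / A| ≤ N * (2 * C₁ / A ^ 2) := by
    have e : ε - N / A = ∑ q ∈ latDisc ⌊R⌋₊, (1 / latG M R b q ε - 1 / A) := by
      rw [Finset.sum_sub_distrib, ← heq, Finset.sum_const, nsmul_eq_mul, hN]
      ring
    rw [e]
    refine (Finset.abs_sum_le_sum_abs _ _).trans ?_
    rw [hN, ← nsmul_eq_mul]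
    refine Finset.sum_le_card_nsmul _ _ _ fun q hq => ?_
    have hl := hlow q hq
    obtain ⟨g1, g2⟩ := hG R b ε q hR hb hRb hε.le ((mem_latDisc_floor hR0.le).1 hq)
    have g2 := g2 hεR
    set g := latG M R b q ε
    have hg : 0 < g := by linarith
    have hAg : |A - g| ≤ C₁ := by rw [abs_le]; constructor <;> linarith
    rw [div_sub_div _ _ hg.ne' hA0.ne', one_mul, mul_one, abs_div, abs_of_pos (mul_pos hg hA0)]
    calc |A - g| / (g * A) ≤ C₁ / (A / 2 * A) := by gcongr
      _ = 2 * C₁ / A ^ 2 := by field_simp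
  have hcount : |N / A - π * R / A| ≤ 16 * π ^ 3 * R / A ^ 2 := by
    rw [← sub_div, abs_div, abs_of_pos hA0]
    calc |N - π * R| / A ≤ 4 * π * √R / A := by
          gcongr
          exact abs_le.2 hcard
      _ = 4 * π * √R * A / A ^ 2 := by field_simp
      _ ≤ 4 * π * √R * (4 * π ^ 2 * √R) / A ^ 2 := by gcongr
      _ = 16 * π ^ 3 * (√R) ^ 2 / A ^ 2 := by ring
      _ = _ := by rw [Real.sq_sqrt hR0.le]
  have hmain : m * R / Λ = π * R / A := by
    rw [hA]; field_simp
  rw [hmain]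
  calc |ε - π * R / A| ≤ |ε - N / A| + |N / A - π * R / A| := abs_sub_le _ _ _
    _ ≤ 5 * π * R * (2 * C₁ / A ^ 2) + 16 * π ^ 3 * R / A ^ 2 := by
        refine add_le_add (hsum.trans ?_) hcount
        gcongr
    _ = (10 * π * C₁ + 16 * π ^ 3) * (m / π) ^ 2 * R / Λ ^ 2 := by
        rw [hA]; field_simp; ring

lemma nsq_kvec (L : ℝ) (z : ℤ × ℤ) : nsq (kvec L z) = (2 * π / L) ^ 2 * latSq z := by
  simp only [nsq, kvec, latSq]; ring

lemma nsq_kvec_sub (L : ℝ) (q z : ℤ × ℤ) :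
    nsq (kvec L q - kvec L z) = (2 * π / L) ^ 2 * latSq (q - z) := by
  simp only [nsq, kvec, latSq, Prod.fst_sub, Prod.snd_sub]; push_cast; ring

lemma Gfun_kvec {L : ℝ} (hL : 0 < L) (M E_B μ e : ℝ) (q : ℤ × ℤ) :
    Gfun M L E_B μ (kvec L q) (-(nsq (kvec L q)) - e) = 1 / (4 * π ^ 2) *
      latG M (μ / (2 * π / L) ^ 2) (|E_B| / (2 * π / L) ^ 2) q (-e / (2 * π / L) ^ 2) := by
  have hh : 0 < (2 * π / L) ^ 2 := by have := Real.pi_pos; positivity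
  have hc : 1 / (4 * π ^ 2) = 1 / L ^ 2 * (1 / (2 * π / L) ^ 2) := by
    have := Real.pi_pos; field_simp; norm_num
  rw [hc]
  unfold Gfun latG
  simp only [nsq_kvec, nsq_kvec_sub]
  generalize (2 * π / L) ^ 2 = H at hh
  rw [mul_assoc]
  congr 1
  rw [← tsum_mul_left]
  refine tsum_congr fun z => ?_
  have e1 : (1 + 1 / M) * (H * latSq z) + |E_B|
      = H * ((1 + 1 / M) * latSq z + |E_B| / H) := by field_simp
  have e2 : 1 / M * (H * latSq (q - z)) + H * latSq z + (-(H * latSq q) - e)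
      = H * (excEnergy M q z + -e / H) := by
    have : H * (-e / H) = -e := by field_simp
    unfold excEnergy; rw [mul_add, this]; ring
  have e3 : chi μ (H * latSq z) = if μ / H < latSq z then 1 else 0 := by
    unfold chi
    simp only [div_lt_iff₀ hh, mul_comm]
  rw [e1, e2, e3, mul_sub, div_mul_div_comm, div_mul_div_comm, one_mul, one_mul]

theorem stmt_6 (M : ℝ) (hM : 1 < M) :
    ∃ c₀ C : ℝ, 0 < c₀ ∧ 0 < C ∧
      ∀ L μ E_B eP : ℝ, 0 < L → 0 < μ → E_B < 0 →
        1 ≤ L ^ 2 * |E_B| → c₀ ≤ μ / |E_B| →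
        eP < 0 → PolaronEq M L E_B μ eP →
        |eP + (1 + 1 / M) * μ / Real.log (μ / |E_B|)| ≤
          C * μ / (Real.log (μ / |E_B|)) ^ 2 := by
  have hM0 : 0 < M := by linarith
  obtain ⟨c₀, C, hc₀, hC, h⟩ := exists_abs_polaron_sub_le hM0
  refine ⟨c₀, C, hc₀, hC, fun L μ E_B e hL hμ hE hLE hc he hpol => ?_⟩
  have hpi := Real.pi_pos
  have hh : 0 < (2 * π / L) ^ 2 := by positivity
  have hE0 : 0 < |E_B| := abs_pos.2 hE.ne
  have hcoef : 1 / L ^ 2 * (4 * π ^ 2) = (2 * π / L) ^ 2 := by field_simp; norm_num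
  have hb : 1 / (4 * π ^ 2) ≤ |E_B| / (2 * π / L) ^ 2 := by
    rw [← hcoef, div_le_div_iff₀ (by positivity) (by positivity)]
    have : |E_B| * (4 * π ^ 2) = L ^ 2 * |E_B| * (1 / L ^ 2 * (4 * π ^ 2)) := by field_simp
    rw [this]
    exact mul_le_mul_of_nonneg_right hLE (by positivity)
  have hratio : μ / (2 * π / L) ^ 2 / (|E_B| / (2 * π / L) ^ 2) = μ / |E_B| := by field_simp
  have heq : -e / (2 * π / L) ^ 2 = ∑ q ∈ latDisc ⌊μ / (2 * π / L) ^ 2⌋₊,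
      1 / latG M (μ / (2 * π / L) ^ 2) (|E_B| / (2 * π / L) ^ 2) q (-e / (2 * π / L) ^ 2) := by
    rw [div_eq_iff hh.ne']
    have hpol' : -e = 1 / L ^ 2 * ∑' z : ℤ × ℤ, if nsq (kvec L z) ≤ μ then
        1 / Gfun M L E_B μ (kvec L z) (-(nsq (kvec L z)) - e) else 0 := by
      unfold PolaronEq at hpol; linarith
    have hmem : ∀ z, z ∈ latDisc ⌊μ / (2 * π / L) ^ 2⌋₊ ↔ nsq (kvec L z) ≤ μ := by
      intro z
      rw [mem_latDisc_floor (by positivity), nsq_kvec, le_div_iff₀ hh, mul_comm]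
    rw [tsum_eq_sum (s := latDisc ⌊μ / (2 * π / L) ^ 2⌋₊)
      fun z hz => if_neg fun h' => hz ((hmem z).2 h')] at hpol'
    refine hpol'.trans ?_
    rw [mul_comm (Finset.sum _ _), ← hcoef, mul_assoc, Finset.mul_sum (a := 4 * π ^ 2), hcoef]
    congr 1
    refine Finset.sum_congr rfl fun z hz => ?_
    rw [if_pos ((hmem z).1 hz), Gfun_kvec hL, one_div_mul_eq_div, one_div_div, mul_one_div]
  have := h _ _ _ hb (by rwa [hratio]) (div_pos (neg_pos.2 he) hh) heq
  rw [hratio] at this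
  set H := (2 * π / L) ^ 2
  set Λ := Real.log (μ / |E_B|)
  have e1 : -e / H - (1 + 1 / M) * (μ / H) / Λ = -(e + (1 + 1 / M) * μ / Λ) / H := by ring
  have e2 : C * (μ / H) / Λ ^ 2 = C * μ / Λ ^ 2 / H := by ring
  rw [e1, e2, abs_div, abs_neg, abs_of_pos hh] at this
  exact (div_le_div_iff_of_pos_right hh).1 this
end

section
/- There exist constants c₀, C > 0 such that for all M > 0, L > 0, μ > 0, E_B < 0, q ∈ ℝ² and τ > −μ with L²|E_B| ≥ 1 and μ/|E_B| ≥ c₀: (1/L²) Σ_{k ∈ Λ_L, μ < |k|² < μ + μ/log(μ/|E_B|)} 1/((1/M)|q−k|² + |k|² + τ) ≤ C μ/((μ+τ) log(μ/|E_B|)). -/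
open Real MeasureTheory Set

/-- An interval `[s, s + w]` contains at most `w + 1` integers. -/
lemma card_Icc_ceil_floor_le (s w : ℝ) (hw : 0 ≤ w) :
    ((Finset.Icc ⌈s⌉ ⌊s + w⌋).card : ℝ) ≤ w + 1 := by
  rw [Int.card_Icc]
  have h1 := Int.floor_le (s + w)
  have h2 := Int.le_ceil s
  rcases le_total (⌊s + w⌋ + 1 - ⌈s⌉) 0 with h | h
  · rw [Int.toNat_of_nonpos h]
    push_cast
    linarith
  · have h3 : ((⌊s + w⌋ + 1 - ⌈s⌉).toNat : ℝ) = ((⌊s + w⌋ + 1 - ⌈s⌉ : ℤ) : ℝ) := by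
      exact_mod_cast Int.toNat_of_nonneg h
    rw [h3]
    push_cast
    linarith

/-- If `r ^ 2 < x ^ 2 + y ^ 2 < r ^ 2 + r ^ 2 / l` and `|x| ≤ |y|`, then `|y|` lies in an interval
of length `2 * r / l` starting at `√(r ^ 2 - x ^ 2)`. -/
lemma annulus_fiber_bounds {r l x y : ℝ} (hr : 0 < r) (hl : 1 ≤ l) (hxy : |x| ≤ |y|)
    (h1 : r ^ 2 < x ^ 2 + y ^ 2) (h2 : x ^ 2 + y ^ 2 < r ^ 2 + r ^ 2 / l) :
    |x| ≤ r ∧ √(r ^ 2 - x ^ 2) ≤ |y| ∧ |y| ≤ √(r ^ 2 - x ^ 2) + 2 * r / l := by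
  have hsq : x ^ 2 ≤ y ^ 2 := sq_le_sq.2 hxy
  have hd : r ^ 2 / l ≤ r ^ 2 := div_le_self (sq_nonneg r) hl
  have hx : x ^ 2 ≤ r ^ 2 := by linarith
  refine ⟨abs_le_of_sq_le_sq hx hr.le, ?_, ?_⟩
  · rw [← Real.sqrt_sq_eq_abs]
    exact Real.sqrt_le_sqrt (by linarith)
  · have hs := Real.sq_sqrt (sub_nonneg.2 hx)
    have hs0 := Real.sqrt_nonneg (r ^ 2 - x ^ 2)
    set s := √(r ^ 2 - x ^ 2)
    have hy0 := abs_nonneg y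
    have hyy := sq_abs y
    have hy : r / 2 ≤ |y| := by nlinarith
    by_contra! hc
    have hp : 0 < 2 * r / l := by positivity
    have he : r ^ 2 / l = (2 * r / l) * (r / 2) := by ring
    nlinarith [mul_le_mul (show 2 * r / l ≤ |y| - s by linarith)
      (show r / 2 ≤ |y| + s by linarith) (by positivity) (by linarith)]

/-- The annulus `r ^ 2 < |z| ^ 2 < r ^ 2 + r ^ 2 / l` contains `O(r ^ 2 / l)` integer points, as long
as `r` is bounded below and `l` is at most of order `r`. -/
lemma exists_finset_annulus {r l : ℝ} (hr : 1 ≤ 8 * r) (hl : 1 ≤ l) (hlr : l ≤ 13 * r) :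
    ∃ T : Finset (ℤ × ℤ),
      (∀ z : ℤ × ℤ, r ^ 2 < (z.1 : ℝ) ^ 2 + (z.2 : ℝ) ^ 2 →
        (z.1 : ℝ) ^ 2 + (z.2 : ℝ) ^ 2 < r ^ 2 + r ^ 2 / l → z ∈ T) ∧
      (T.card : ℝ) ≤ 600 * r ^ 2 / l := by
  have hr0 : 0 < r := by linarith
  have hl0 : 0 < l := by linarith
  set w := 2 * r / l with hw
  have hw0 : 0 ≤ w := by positivity
  let I : ℤ → Finset ℤ := fun x =>
    Finset.Icc ⌈√(r ^ 2 - (x : ℝ) ^ 2)⌉ ⌊√(r ^ 2 - (x : ℝ) ^ 2) + w⌋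
  let F : ℤ → Finset ℤ := fun x => I x ∪ (I x).image Neg.neg
  let B : Finset (ℤ × ℤ) :=
    (Finset.Icc ⌈-r⌉ ⌊-r + 2 * r⌋).biUnion fun x => (F x).image (Prod.mk x)
  have hB : ∀ x y : ℤ, |(x : ℝ)| ≤ |(y : ℝ)| → r ^ 2 < (x : ℝ) ^ 2 + (y : ℝ) ^ 2 →
      (x : ℝ) ^ 2 + (y : ℝ) ^ 2 < r ^ 2 + r ^ 2 / l → (x, y) ∈ B := by
    intro x y hxy h1 h2
    obtain ⟨hx, hy1, hy2⟩ := annulus_fiber_bounds hr0 hl hxy h1 h2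
    have hx' := abs_le.1 hx
    have hy : |y| ∈ I x :=
      Finset.mem_Icc.2 ⟨Int.ceil_le.2 (by push_cast; exact hy1),
        Int.le_floor.2 (by push_cast; exact hy2)⟩
    refine Finset.mem_biUnion.2 ⟨x, Finset.mem_Icc.2
      ⟨Int.ceil_le.2 hx'.1, Int.le_floor.2 (by linarith [hx'.2])⟩,
      Finset.mem_image.2 ⟨y, Finset.mem_union.2 ?_, rfl⟩⟩
    rcases abs_choice y with h | h
    · exact Or.inl (h ▸ hy)
    · exact Or.inr (Finset.mem_image.2 ⟨|y|, hy, by rw [h, neg_neg]⟩)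
  have hF : ∀ x, ((F x).card : ℝ) ≤ 2 * (w + 1) := by
    intro x
    have h1 : ((F x).card : ℝ) ≤ (I x).card + (I x).card := by
      exact_mod_cast (Finset.card_union_le _ _).trans
        (Nat.add_le_add_left Finset.card_image_le _)
    linarith [card_Icc_ceil_floor_le (√(r ^ 2 - (x : ℝ) ^ 2)) w hw0]
  have hBc : (B.card : ℝ) ≤ (2 * r + 1) * (2 * (w + 1)) := by
    calc (B.card : ℝ)
        ≤ ∑ x ∈ Finset.Icc ⌈-r⌉ ⌊-r + 2 * r⌋, ((F x).card : ℝ) := by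
          exact_mod_cast Finset.card_biUnion_le.trans
            (Finset.sum_le_sum fun x _ => Finset.card_image_le)
      _ ≤ (Finset.Icc ⌈-r⌉ ⌊-r + 2 * r⌋).card • (2 * (w + 1)) :=
          Finset.sum_le_card_nsmul _ _ _ fun x _ => hF x
      _ ≤ (2 * r + 1) * (2 * (w + 1)) := by
          rw [nsmul_eq_mul]
          exact mul_le_mul_of_nonneg_right
            (card_Icc_ceil_floor_le (-r) (2 * r) (by positivity)) (by positivity)
  refine ⟨B ∪ B.image Prod.swap, ?_, ?_⟩
  · rintro ⟨x, y⟩ h1 h2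
    rcases le_total |(x : ℝ)| |(y : ℝ)| with h | h
    · exact Finset.mem_union_left _ (hB x y h h1 h2)
    · exact Finset.mem_union_right _ (Finset.mem_image.2
        ⟨(y, x), hB y x h (by linarith) (by linarith), rfl⟩)
  · have h1 : ((B ∪ B.image Prod.swap).card : ℝ) ≤ B.card + B.card := by
      exact_mod_cast (Finset.card_union_le _ _).trans
        (Nat.add_le_add_left Finset.card_image_le _)
    have h2 : w + 1 ≤ 15 * r / l := by
      rw [hw, div_add_one hl0.ne']
      gcongr
      linarith
    have h3 : (2 * r + 1) * (2 * (w + 1)) ≤ (10 * r) * (2 * (15 * r / l)) := by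
      gcongr
      linarith
    have h4 : (10 * r) * (2 * (15 * r / l)) * 2 = 600 * r ^ 2 / l := by ring
    linarith

theorem stmt_10 :
    ∃ c₀ C : ℝ, 0 < c₀ ∧ 0 < C ∧
      ∀ (M L μ E_B τ : ℝ) (q : ℝ × ℝ), 0 < M → 0 < L → 0 < μ → E_B < 0 → -μ < τ →
        1 ≤ L ^ 2 * |E_B| → c₀ ≤ μ / |E_B| →
        (1 / L ^ 2) * (∑' z : ℤ × ℤ,
            if μ < nsq (kvec L z) ∧ nsq (kvec L z) < μ + μ / Real.log (μ / |E_B|) then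
              1 / ((1 / M) * nsq (q - kvec L z) + nsq (kvec L z) + τ) else 0)
          ≤ C * μ / ((μ + τ) * Real.log (μ / |E_B|)) := by
  refine ⟨Real.exp 1, 600, Real.exp_pos 1, by norm_num, ?_⟩
  intro M L μ E_B τ q hM hL hμ hE hτ hLE hc
  have hE0 : 0 < |E_B| := abs_pos.2 hE.ne
  have hx0 : 0 < μ / |E_B| := by positivity
  have hl : 1 ≤ Real.log (μ / |E_B|) := (Real.le_log_iff_exp_le hx0).2 hc
  have hx1 : 1 ≤ μ / |E_B| := (Real.one_le_exp zero_le_one).trans hc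
  have hxL : μ / |E_B| ≤ (√μ * L) ^ 2 := by
    rw [mul_pow, Real.sq_sqrt hμ.le, div_le_iff₀ hE0]
    nlinarith
  set l := Real.log (μ / |E_B|)
  set p := √μ * L with hp
  have hp0 : 0 < p := by positivity
  have hp1 : 1 ≤ p := by nlinarith
  have hlp : l ≤ 2 * p := by
    calc l ≤ Real.log (p ^ 2) := Real.log_le_log hx0 hxL
      _ = 2 * Real.log p := by rw [Real.log_pow]; norm_num
      _ ≤ 2 * p := by linarith [Real.log_le_sub_one_of_pos hp0]
  have hπ := Real.pi_pos
  have hπ4 := Real.pi_lt_d2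
  obtain ⟨r, hr⟩ : ∃ r, r = p / (2 * π) := ⟨_, rfl⟩
  have hpr : p = 2 * π * r := by rw [hr]; field_simp
  have hr0 : 0 < r := by rw [hr]; positivity
  have hrμ : (2 * π / L) ^ 2 * r ^ 2 = μ := by
    rw [hr, hp]
    field_simp
    exact Real.sq_sqrt hμ.le
  obtain ⟨T, hT, hTc⟩ := exists_finset_annulus (r := r) (l := l) (by nlinarith) hl (by nlinarith)
  have hn : ∀ z, nsq (kvec L z) = (2 * π / L) ^ 2 * ((z.1 : ℝ) ^ 2 + (z.2 : ℝ) ^ 2) := by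
    intro z
    simp only [nsq, kvec]
    ring
  have ha : 0 < (2 * π / L) ^ 2 := by positivity
  have hμτ : 0 < μ + τ := by linarith
  have hl0 : 0 < l := by linarith
  rw [tsum_eq_sum (s := T)]
  · calc _ ≤ (1 / L ^ 2) * (T.card • (1 / (μ + τ))) := by
          refine mul_le_mul_of_nonneg_left (Finset.sum_le_card_nsmul _ _ _ fun z _ => ?_)
            (by positivity)
          split_ifs with h
          · refine one_div_le_one_div_of_le hμτ ?_
            have : 0 ≤ (1 / M) * nsq (q - kvec L z) := by unfold nsq; positivity
            linarith [h.1]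
          · positivity
      _ ≤ (1 / L ^ 2) * ((600 * r ^ 2 / l) * (1 / (μ + τ))) := by
          rw [nsmul_eq_mul]
          gcongr
      _ ≤ (2 * π / L) ^ 2 * ((600 * r ^ 2 / l) * (1 / (μ + τ))) := by
          gcongr
          rw [div_pow]
          gcongr
          nlinarith [Real.pi_gt_three]
      _ = 600 * ((2 * π / L) ^ 2 * r ^ 2) / ((μ + τ) * l) := by
          field_simp
      _ = _ := by rw [hrμ]
  · intro z hz
    refine if_neg fun h => hz (hT z ?_ ?_)
    · have := h.1
      rw [hn, ← hrμ] at this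
      exact lt_of_mul_lt_mul_left this ha.le
    · have := h.2
      rw [hn, ← hrμ, mul_div_assoc _ _ l, ← mul_add] at this
      exact lt_of_mul_lt_mul_left this ha.le
end

section
/- Let L > 0, μ > 0, ε ∈ (0,1) and λ ≤ E₀(μ). For every finite subset S ⊂ Λ_L with card S = N(μ) − 1, setting β = Σ_{k ∈ S} |k|² and γ = Σ_{k ∈ S, |k|² > μ/ε} |k|², one has (1 − ε)·γ ≤ β − λ + 2μ. -/
open Real MeasureTheory Set

/-- Only finitely many lattice points lie in a given disc. -/
theorem finite_nsq_kvec_le {L : ℝ} (hL : 0 < L) (μ : ℝ) :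
    {z : ℤ × ℤ | nsq (kvec L z) ≤ μ}.Finite := by
  set c : ℝ := 2 * Real.pi / L with hc
  have hc0 : 0 < c := by positivity
  set M : ℤ := ⌈μ / c ^ 2⌉ with hM
  have key : ∀ a : ℤ, (c * a) ^ 2 ≤ μ → -M ≤ a ∧ a ≤ M := by
    intro a ha
    have h1 : (a : ℝ) ^ 2 ≤ μ / c ^ 2 := by
      rw [le_div_iff₀ (by positivity)]
      linarith [mul_pow c (a : ℝ) 2]
    have h2 : a ^ 2 ≤ M := by
      exact_mod_cast h1.trans (Int.le_ceil _)
    have h3 : |a| ≤ a ^ 2 := by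
      rw [← sq_abs]
      exact Int.le_self_sq _
    exact abs_le.mp (h3.trans h2)
  refine (Set.finite_Icc ((-M, -M) : ℤ × ℤ) (M, M)).subset fun z hz => ?_
  have hz' : (c * z.1) ^ 2 + (c * z.2) ^ 2 ≤ μ := hz
  have h1 := key z.1 (by linarith [sq_nonneg (c * (z.2 : ℝ))])
  have h2 := key z.2 (by linarith [sq_nonneg (c * (z.1 : ℝ))])
  exact ⟨⟨h1.1, h2.1⟩, ⟨h1.2, h2.2⟩⟩

/-- Summing over a sublevel set minimises the sum of `f - μ` among all finite sets, even after
replacing `f - μ` by its negative part. -/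
theorem sum_sub_le_sum_min {ι : Type*} (f : ι → ℝ) (μ : ℝ) (F S : Finset ι)
    (hF : ∀ i, i ∈ F ↔ f i ≤ μ) :
    ∑ i ∈ F, (f i - μ) ≤ ∑ i ∈ S, min (f i - μ) 0 := by
  classical
  calc ∑ i ∈ F, (f i - μ) = ∑ i ∈ F, min (f i - μ) 0 :=
        Finset.sum_congr rfl fun i hi => (min_eq_left (by linarith [(hF i).1 hi])).symm
    _ = ∑ i ∈ F ∪ S, min (f i - μ) 0 := by
        refine Finset.sum_subset Finset.subset_union_left fun i _ hi => min_eq_right ?_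
        rw [hF, not_le] at hi
        linarith
    _ ≤ ∑ i ∈ S, min (f i - μ) 0 := by
        rw [← Finset.sum_sdiff (Finset.subset_union_right : S ⊆ F ∪ S)]
        exact add_le_of_nonpos_left (Finset.sum_nonpos fun _ _ => min_le_right _ _)

open Classical in
theorem stmt_14 (L μ ε lam : ℝ) (hL : 0 < L) (hμ : 0 < μ) (hε : ε ∈ Set.Ioo (0 : ℝ) 1)
    (hlam : lam ≤ E0 L μ) (S : Finset (ℤ × ℤ)) (hS : S.card = Nmu L μ - 1) :
    (1 - ε) * (∑ z ∈ S.filter (fun z => μ / ε < nsq (kvec L z)), nsq (kvec L z))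
      ≤ (∑ z ∈ S, nsq (kvec L z)) - lam + 2 * μ := by
  obtain ⟨hε0, hε1⟩ := hε
  set F := (finite_nsq_kvec_le hL μ).toFinset with hFdef
  have hF : ∀ z, z ∈ F ↔ nsq (kvec L z) ≤ μ := fun z => by simp [hFdef]
  have hN : Nmu L μ = F.card := Nat.subtype_card F hF
  have hE : E0 L μ = ∑ z ∈ F, nsq (kvec L z) := by
    unfold E0
    rw [tsum_eq_sum (s := F) fun z hz => if_neg fun h => hz ((hF z).2 h)]
    exact Finset.sum_congr rfl fun z hz => if_pos ((hF z).1 hz)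
  have h0 : (0 : ℤ × ℤ) ∈ F := by
    rw [hF]
    simpa [nsq, kvec] using hμ.le
  have hcard : (S.card : ℝ) + 1 = F.card := by
    have := Finset.card_pos.2 ⟨_, h0⟩
    exact_mod_cast (by omega : S.card + 1 = F.card)
  have hmin := sum_sub_le_sum_min (fun z => nsq (kvec L z)) μ F S hF
  have hpt : ∑ z ∈ S, min (nsq (kvec L z) - μ) 0 ≤
      ∑ z ∈ S, (nsq (kvec L z) - μ -
        (1 - ε) * if μ / ε < nsq (kvec L z) then nsq (kvec L z) else 0) := by
    refine Finset.sum_le_sum fun z _ => ?_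
    split_ifs with h
    · rw [div_lt_iff₀ hε0] at h
      exact (min_le_right _ _).trans (by linarith)
    · simp
  simp only [Finset.sum_sub_distrib, Finset.sum_const, nsmul_eq_mul, ← Finset.mul_sum,
    ← Finset.sum_filter] at hmin hpt
  rw [← hcard, ← hE] at hmin
  linarith
end
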